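/- arXiv:math/0405267 — 4 statements merged into one kernel-verified Lean document; each statement's English description precedes it below -/
import Mathlib

section
/- Let q ∈ ℂ, q ≠ 0, d = q + q⁻¹, and let n ≥ 1. Assume the quantum integers [k]_q are nonzero for all 1 ≤ k ≤ n. Then there is an isomorphism of ℂ-algebras from TL_n(d) onto the product over j = 0, 1, …, ⌊n/2⌋ of the full matrix algebras M_{m_j}(ℂ), where m_j = C(n,j) − C(n,j−1) (with C(n,−1) = 0). -/
/-- The Temperley-Lieb relations on the free algebra on `m` generators
`h_1, …, h_m` (0-indexed as `FreeAlgebra.ι ℂ i`, `i : Fin m`, standing for `h_{i+1}`):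
`h_i² = d·h_i`, `h_i h_j = h_j h_i` for `|i−j| ≥ 2`, and `h_i h_{i±1} h_i = h_i`. -/
inductive TLRel (d : ℂ) (m : ℕ) :
    FreeAlgebra ℂ (Fin m) → FreeAlgebra ℂ (Fin m) → Prop
  | sq (i : Fin m) :
      TLRel d m (FreeAlgebra.ι ℂ i * FreeAlgebra.ι ℂ i) (d • FreeAlgebra.ι ℂ i)
  | comm (i j : Fin m) (h : (i : ℕ) + 2 ≤ (j : ℕ) ∨ (j : ℕ) + 2 ≤ (i : ℕ)) :
      TLRel d m (FreeAlgebra.ι ℂ i * FreeAlgebra.ι ℂ j)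
        (FreeAlgebra.ι ℂ j * FreeAlgebra.ι ℂ i)
  | hook (i j : Fin m) (h : (i : ℕ) + 1 = (j : ℕ) ∨ (j : ℕ) + 1 = (i : ℕ)) :
      TLRel d m (FreeAlgebra.ι ℂ i * FreeAlgebra.ι ℂ j * FreeAlgebra.ι ℂ i)
        (FreeAlgebra.ι ℂ i)

/-- The Temperley-Lieb algebra `TL_n(d)`: the unital associative `ℂ`-algebra with
generators `h_1, …, h_{n−1}` and the Temperley-Lieb relations, realized as a
`RingQuot` of the free algebra on `n − 1` generators. -/
abbrev TL (d : ℂ) (n : ℕ) : Type := RingQuot (TLRel d (n - 1))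

/-- The generator of `TL_n(d)` indexed by `i : Fin (n-1)` (representing `h_{i+1}`). -/
noncomputable def TLgen (d : ℂ) (n : ℕ) (i : Fin (n - 1)) : TL d n :=
  RingQuot.mkAlgHom ℂ (TLRel d (n - 1)) (FreeAlgebra.ι ℂ i)

/-- The generator `h_i` of `TL_n(d)` in its 1-based labelling (`1 ≤ i ≤ n−1`),
with junk value `0` outside that range. -/
noncomputable def TLh (d : ℂ) (n : ℕ) (i : ℕ) : TL d n :=
  if h : 1 ≤ i ∧ i ≤ n - 1 then TLgen d n ⟨i - 1, by omega⟩ else 0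

/-- The quantum integer `[k]_q`, equal to `(q^k − q^{−k})/(q − q^{−1})` when `q² ≠ 1`
and to `k·q^{k−1}` when `q = ±1`. -/
noncomputable def qInt (q : ℂ) (k : ℕ) : ℂ :=
  if q ^ 2 = 1 then (k : ℂ) * q ^ (k - 1) else (q ^ k - q⁻¹ ^ k) / (q - q⁻¹)




namespace TLP

/-! ### The Temperley-Lieb side -/

/-- generators indexed by naturals -/
noncomputable def g (d : ℂ) (n i : ℕ) : TL d n :=
  if h : i < n - 1 then TLgen d n ⟨i, h⟩ else 0

lemma TL_ind {d : ℂ} {n : ℕ} (S : Submodule ℂ (TL d n)) (h1 : (1 : TL d n) ∈ S)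
    (hg : ∀ i, i < n - 1 → ∀ z ∈ S, g d n i * z ∈ S) (z : TL d n) : z ∈ S := by
  obtain ⟨x, rfl⟩ := RingQuot.mkAlgHom_surjective ℂ (TLRel d (n - 1)) z
  suffices H : ∀ z ∈ S, RingQuot.mkAlgHom ℂ (TLRel d (n - 1)) x * z ∈ S by
    simpa using H 1 h1
  induction x using FreeAlgebra.induction with
  | grade0 r =>
    intro z hz
    rw [AlgHom.commutes, ← Algebra.smul_def]
    exact S.smul_mem _ hz
  | grade1 i =>
    intro z hz
    have := hg i i.2 z hz
    rw [g, dif_pos i.2] at this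
    exact this
  | mul a b ha hb =>
    intro z hz
    rw [map_mul, mul_assoc]
    exact ha _ (hb _ hz)
  | add a b ha hb =>
    intro z hz
    rw [map_add, add_mul]
    exact S.add_mem (ha _ hz) (hb _ hz)

lemma TL_ext {d : ℂ} {n : ℕ} {B : Type} [Ring B] [Algebra ℂ B] (f k : TL d n →ₐ[ℂ] B)
    (h : ∀ i, i < n - 1 → f (g d n i) = k (g d n i)) : f = k := by
  apply RingQuot.ringQuot_ext'
  apply FreeAlgebra.hom_ext
  funext i
  have := h i i.2
  rw [g, dif_pos i.2] at this
  exact this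

/-- The Temperley-Lieb relations for a sequence of elements. -/
structure Rels (d : ℂ) (m : ℕ) {B : Type} [Ring B] [Algebra ℂ B] (f : ℕ → B) : Prop where
  sq : ∀ i, i < m → f i * f i = d • f i
  comm : ∀ i j, i < m → j < m → i + 2 ≤ j → f i * f j = f j * f i
  hook1 : ∀ i, i + 1 < m → f i * f (i + 1) * f i = f i
  hook2 : ∀ i, i + 1 < m → f (i + 1) * f i * f (i + 1) = f (i + 1)

lemma g_rels (d : ℂ) (n : ℕ) : Rels d (n - 1) (g d n) := by
  constructor
  · intro i hi
    simp only [g, dif_pos hi, TLgen]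
    rw [← map_mul, RingQuot.mkAlgHom_rel ℂ (TLRel.sq ⟨i, hi⟩), map_smul]
  · intro i j hi hj hij
    simp only [g, dif_pos hi, dif_pos hj, TLgen]
    rw [← map_mul, RingQuot.mkAlgHom_rel ℂ (TLRel.comm ⟨i, hi⟩ ⟨j, hj⟩ (Or.inl hij)), map_mul]
  · intro i hi
    have hi' : i < n - 1 := by omega
    simp only [g, dif_pos hi, dif_pos hi', TLgen]
    rw [← map_mul, ← map_mul,
      RingQuot.mkAlgHom_rel ℂ (TLRel.hook ⟨i, hi'⟩ ⟨i + 1, hi⟩ (Or.inl rfl))]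
  · intro i hi
    have hi' : i < n - 1 := by omega
    simp only [g, dif_pos hi, dif_pos hi', TLgen]
    rw [← map_mul, ← map_mul,
      RingQuot.mkAlgHom_rel ℂ (TLRel.hook ⟨i + 1, hi⟩ ⟨i, hi'⟩ (Or.inr rfl))]

lemma TL_lift {d : ℂ} {n : ℕ} {B : Type} [Ring B] [Algebra ℂ B] (f : ℕ → B)
    (hf : Rels d (n - 1) f) :
    ∃ φ : TL d n →ₐ[ℂ] B, ∀ i, i < n - 1 → φ (g d n i) = f i := by
  refine ⟨RingQuot.liftAlgHom ℂ ⟨FreeAlgebra.lift ℂ (fun i : Fin (n - 1) => f i), ?_⟩, ?_⟩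
  · intro x y h
    cases h with
    | sq i => simpa using hf.sq i i.2
    | comm i j h =>
      rcases h with h | h
      · simpa using hf.comm i j i.2 j.2 h
      · simpa using (hf.comm j i j.2 i.2 h).symm
    | hook i j h =>
      rcases h with h | h
      · have := hf.hook1 i (by omega)
        rw [h] at this
        simpa using this
      · have := hf.hook2 j (by omega)
        rw [h] at this
        simpa using this
  · intro i hi
    rw [g, dif_pos hi, TLgen, RingQuot.liftAlgHom_mkAlgHom_apply]
    simp

lemma exists_iota (d : ℂ) (n : ℕ) :
    ∃ φ : TL d n →ₐ[ℂ] TL d (n + 1), ∀ i, i < n - 1 → φ (g d n i) = g d (n + 1) i := by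
  apply TL_lift
  have := g_rels d (n + 1)
  exact ⟨fun i hi => this.sq i (by omega), fun i j hi hj => this.comm i j (by omega) (by omega),
    fun i hi => this.hook1 i (by omega), fun i hi => this.hook2 i (by omega)⟩

/-- the standard map `TL_n → TL_{n+1}` -/
noncomputable def iota (d : ℂ) (n : ℕ) : TL d n →ₐ[ℂ] TL d (n + 1) := (exists_iota d n).choose

lemma iota_g (d : ℂ) (n i : ℕ) (hi : i < n - 1) : iota d n (g d n i) = g d (n + 1) i :=
  (exists_iota d n).choose_spec i hi

lemma g_comm (d : ℂ) (n : ℕ) (x : TL d n) :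
    g d (n + 2) n * iota d (n + 1) (iota d n x) = iota d (n + 1) (iota d n x) * g d (n + 2) n := by
  let S : Submodule ℂ (TL d n) :=
    { carrier := {x | g d (n + 2) n * iota d (n + 1) (iota d n x)
        = iota d (n + 1) (iota d n x) * g d (n + 2) n}
      add_mem' := by
        intro a b ha hb
        simp only [Set.mem_setOf_eq] at *
        simp only [map_add, mul_add, add_mul, ha, hb]
      zero_mem' := by simp
      smul_mem' := by
        intro c a ha
        simp only [Set.mem_setOf_eq] at *
        simp only [map_smul, mul_smul_comm, smul_mul_assoc, ha] }
  refine TL_ind S ?_ ?_ x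
  · change _ = _
    simp
  · intro i hi z hz
    change _ = _ at hz
    change _ = _
    rw [map_mul, map_mul, iota_g _ _ _ hi, iota_g _ _ _ (by omega), ← mul_assoc,
      ← (g_rels d (n + 2)).comm i n (by omega) (by omega) (by omega), mul_assoc, hz, mul_assoc]

/-- the ideal generated by the last generator -/
noncomputable def I (d : ℂ) (n : ℕ) : Submodule ℂ (TL d (n + 2)) :=
  Submodule.span ℂ {z | ∃ x y, z = iota d (n + 1) x * g d (n + 2) n * iota d (n + 1) y}

lemma TL_one (d : ℂ) (n : ℕ) (hn : n ≤ 1) (z : TL d n) : ∃ c : ℂ, z = algebraMap ℂ _ c := by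
  have := TL_ind (Submodule.span ℂ {(1 : TL d n)}) (Submodule.mem_span_singleton_self _)
    (fun i hi => by omega) z
  obtain ⟨c, rfl⟩ := Submodule.mem_span_singleton.1 this
  exact ⟨c, by rw [Algebra.algebraMap_eq_smul_one]⟩

lemma span_of_Q (d : ℂ) (n : ℕ)
    (Q : ∀ z : TL d (n + 1), ∃ w : TL d n, g d (n + 2) n * iota d (n + 1) z * g d (n + 2) n
      = iota d (n + 1) (iota d n w) * g d (n + 2) n) (z : TL d (n + 2)) :
    ∃ c : ℂ, ∃ w ∈ I d n, z = algebraMap ℂ _ c + w := by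
  have hgI : g d (n + 2) n ∈ I d n := Submodule.subset_span ⟨1, 1, by simp⟩
  have hleft : ∀ i, i < n + 1 → ∀ z ∈ I d n, g d (n + 2) i * z ∈ I d n := by
    intro i hi z hz
    induction hz using Submodule.span_induction with
    | mem z hz =>
      obtain ⟨x, y, rfl⟩ := hz
      by_cases h : i = n
      · subst h
        obtain ⟨w, hw⟩ := Q x
        refine Submodule.subset_span ⟨iota d _ w, y, ?_⟩
        rw [← hw]; simp only [mul_assoc]
      · refine Submodule.subset_span ⟨g d (n + 1) i * x, y, ?_⟩
        rw [map_mul, iota_g _ _ _ (by omega)]; simp only [mul_assoc]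
    | zero => simp
    | add a b _ _ ha hb => rw [mul_add]; exact Submodule.add_mem _ ha hb
    | smul c a _ ha => rw [mul_smul_comm]; exact Submodule.smul_mem _ _ ha
  have hright : ∀ i, i < n → ∀ z ∈ I d n, z * g d (n + 2) i ∈ I d n := by
    intro i hi z hz
    induction hz using Submodule.span_induction with
    | mem z hz =>
      obtain ⟨x, y, rfl⟩ := hz
      refine Submodule.subset_span ⟨x, y * g d (n + 1) i, ?_⟩
      rw [map_mul, iota_g _ _ _ (by omega)]; simp only [mul_assoc]
    | zero => simp
    | add a b _ _ ha hb => rw [add_mul]; exact Submodule.add_mem _ ha hb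
    | smul c a _ ha => rw [smul_mul_assoc]; exact Submodule.smul_mem _ _ ha
  have hgen : ∀ k, k ≤ n → g d (n + 2) (n - k) ∈ I d n := by
    intro k
    induction k with
    | zero => intro _; simpa using hgI
    | succ k ih =>
      intro hk
      have h1 := ih (by omega)
      have h2 := (g_rels d (n + 2)).hook1 (n - (k + 1)) (by omega)
      rw [← h2]
      have : n - (k + 1) + 1 = n - k := by omega
      rw [this]
      exact hright _ (by omega) _ (hleft _ (by omega) _ h1)
  have := TL_ind (Submodule.span ℂ {(1 : TL d (n + 2))} ⊔ I d n)
    (Submodule.mem_sup_left (Submodule.mem_span_singleton_self _)) ?_ z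
  · obtain ⟨a, ha, w, hw, rfl⟩ := Submodule.mem_sup.1 this
    obtain ⟨c, rfl⟩ := Submodule.mem_span_singleton.1 ha
    exact ⟨c, w, hw, by rw [Algebra.algebraMap_eq_smul_one]⟩
  · intro i hi z hz
    obtain ⟨a, ha, w, hw, rfl⟩ := Submodule.mem_sup.1 hz
    obtain ⟨c, rfl⟩ := Submodule.mem_span_singleton.1 ha
    apply Submodule.mem_sup_right
    rw [mul_add, mul_smul_comm, mul_one]
    refine Submodule.add_mem _ (Submodule.smul_mem _ _ ?_) (hleft _ hi _ hw)
    have := hgen (n - i) (by omega)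
    rwa [show n - (n - i) = i by omega] at this

lemma Q_all (d : ℂ) (n : ℕ) (z : TL d (n + 1)) :
    ∃ w : TL d n, g d (n + 2) n * iota d (n + 1) z * g d (n + 2) n
      = iota d (n + 1) (iota d n w) * g d (n + 2) n := by
  induction n with
  | zero =>
    obtain ⟨c, rfl⟩ := TL_one d 1 le_rfl z
    refine ⟨algebraMap ℂ _ (d * c), ?_⟩
    have := (g_rels d 2).sq 0 (by omega)
    simp only [AlgHom.commutes, zero_add]
    rw [← Algebra.commutes, mul_assoc, this, ← Algebra.smul_def, ← Algebra.smul_def, smul_smul,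
      mul_comm]
  | succ n ih =>
    obtain ⟨c, w, hw, rfl⟩ := span_of_Q d n ih z
    have h1 : ∃ u : TL d (n + 1), g d (n + 1 + 2) (n + 1) * iota d (n + 1 + 1) w *
        g d (n + 1 + 2) (n + 1)
        = iota d (n + 1 + 1) (iota d (n + 1) u) * g d (n + 1 + 2) (n + 1) := by
      induction hw using Submodule.span_induction with
      | mem z hz =>
        obtain ⟨x, y, rfl⟩ := hz
        refine ⟨x * y, ?_⟩
        simp only [map_mul]
        rw [iota_g _ _ _ (by omega)]
        have hx := g_comm d (n + 1) x
        have hy := g_comm d (n + 1) y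
        have hk := (g_rels d (n + 3)).hook2 n (by omega)
        generalize iota d (n + 1 + 1) (iota d (n + 1) x) = X at *
        generalize iota d (n + 1 + 1) (iota d (n + 1) y) = Y at *
        change g d (n + 3) (n + 1) * X = _ at hx
        change g d (n + 3) (n + 1) * Y = _ at hy
        change g d (n + 3) (n + 1) * (X * g d (n + 3) n * Y) * g d (n + 3) (n + 1) = X * Y *
          g d (n + 3) (n + 1)
        calc _ = (g d (n + 3) (n + 1) * X) * g d (n + 3) n * (Y * g d (n + 3) (n + 1)) := by
              simp only [mul_assoc]
          _ = X * (g d (n + 3) (n + 1) * g d (n + 3) n * g d (n + 3) (n + 1)) * Y := by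
              rw [hx, ← hy]; simp only [mul_assoc]
          _ = _ := by rw [hk, mul_assoc, hy, mul_assoc]
      | zero => exact ⟨0, by simp⟩
      | add a b _ _ ha hb =>
        obtain ⟨u, hu⟩ := ha
        obtain ⟨v, hv⟩ := hb
        exact ⟨u + v, by simp only [map_add, mul_add, add_mul, hu, hv]⟩
      | smul c a _ ha =>
        obtain ⟨u, hu⟩ := ha
        exact ⟨c • u, by simp only [map_smul, mul_smul_comm, smul_mul_assoc, hu]⟩
    obtain ⟨u, hu⟩ := h1
    refine ⟨algebraMap ℂ _ (d * c) + u, ?_⟩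
    have := (g_rels d (n + 1 + 2)).sq (n + 1) (by omega)
    simp only [map_add, AlgHom.commutes, mul_add, add_mul, hu]
    rw [← Algebra.commutes, mul_assoc, this, ← Algebra.smul_def, ← Algebra.smul_def, smul_smul,
      mul_comm]

lemma TL_span (d : ℂ) (n : ℕ) (z : TL d (n + 2)) :
    ∃ c : ℂ, ∃ w ∈ I d n, z = algebraMap ℂ _ c + w :=
  span_of_Q d n (Q_all d n) z

/-! ### The path side -/

/-- neighbours on the half line -/
def nbr (a : ℕ) : Finset ℕ := if a = 0 then {1} else {a - 1, a + 1}

lemma mem_nbr {a c : ℕ} : c ∈ nbr a ↔ (c = a + 1 ∨ c + 1 = a) := by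
  unfold nbr
  split_ifs with h
  · simp; omega
  · simp; omega

lemma nbr_symm {a c : ℕ} (h : c ∈ nbr a) : a ∈ nbr c := by
  rw [mem_nbr] at *; omega

/-- finite types graded by naturals -/
structure Gr where
  T : Type
  ft : Fintype T
  de : DecidableEq T
  e : T → ℕ

instance (X : Gr) : Fintype X.T := X.ft
instance (X : Gr) : DecidableEq X.T := X.de

/-- extending paths by one step -/
def Gr.step (X : Gr) : Gr where
  T := Σ x : X.T, {c // c ∈ nbr (X.e x)}
  ft := inferInstance
  de := inferInstance
  e := fun p => p.2.1

def Gr.par {X : Gr} (p : X.step.T) : X.T := p.1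
def Gr.mk' {X : Gr} (x : X.T) (c : ℕ) (h : c ∈ nbr (X.e x)) : X.step.T := ⟨x, c, h⟩

open Gr

lemma par_mk {X : Gr} (x : X.T) (c : ℕ) (h : c ∈ nbr (X.e x)) : par (mk' x c h) = x := rfl
lemma e_mk {X : Gr} (x : X.T) (c : ℕ) (h : c ∈ nbr (X.e x)) : X.step.e (mk' x c h) = c := rfl
lemma e_mem {X : Gr} (p : X.step.T) : X.step.e p ∈ nbr (X.e (par p)) := p.2.2
lemma e_mem' {X : Gr} (p : X.step.T) : X.e (par p) ∈ nbr (X.step.e p) := nbr_symm p.2.2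
lemma mem_mk {X : Gr} {x : X.T} {b : ℕ} {hb : b ∈ nbr (X.e x)} {c : ℕ} (h : c ∈ nbr b) :
    c ∈ nbr (X.step.e (mk' x b hb)) := h
lemma step_ext {X : Gr} {p q : X.step.T} (h : par p = par q) (h' : X.step.e p = X.step.e q) :
    p = q := by
  obtain ⟨x, c, hc⟩ := p
  obtain ⟨y, c', hc'⟩ := q
  obtain rfl : x = y := h
  obtain rfl : c = c' := h'
  rfl

lemma sum_step {X : Gr} (F : X.T → ℕ → ℂ) :
    ∑ p : X.step.T, F (par p) (X.step.e p) = ∑ x : X.T, ∑ c ∈ nbr (X.e x), F x c := by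
  have : ∑ p : X.step.T, F (par p) (X.step.e p) =
      ∑ x : X.T, ∑ c : {c // c ∈ nbr (X.e x)}, F x c :=
    Fintype.sum_sigma (fun p : (Σ x : X.T, {c // c ∈ nbr (X.e x)}) => F p.1 p.2.1)
  rw [this]
  refine Finset.sum_congr rfl fun x _ => ?_
  exact Finset.sum_coe_sort (nbr (X.e x)) (fun c => F x c)

lemma sum_step' {X : Gr} (G : X.step.T → ℂ) (F : X.T → ℕ → ℂ)
    (h : ∀ p, G p = F (par p) (X.step.e p)) :
    ∑ p : X.step.T, G p = ∑ x : X.T, ∑ c ∈ nbr (X.e x), F x c := by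
  rw [← sum_step]
  exact Finset.sum_congr rfl fun p _ => h p

/-- degree-preserving matrices -/
def Blk {X Y : Gr} (M : Matrix X.T Y.T ℂ) : Prop := ∀ s t, M s t ≠ 0 → X.e s = Y.e t

/-- extension of matrices to longer paths -/
def J {X Y : Gr} (M : Matrix X.T Y.T ℂ) : Matrix X.step.T Y.step.T ℂ :=
  fun p q => if X.step.e p = Y.step.e q then M (par p) (par q) else 0

lemma J_blk {X Y : Gr} (M : Matrix X.T Y.T ℂ) : Blk (J M) := by
  intro s t h
  by_contra h'
  exact h (if_neg h')

lemma J_mul {X Y Z : Gr} (M : Matrix X.T Y.T ℂ) (N : Matrix Y.T Z.T ℂ) (hM : Blk M) :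
    J (M * N) = J M * J N := by
  ext p q
  rw [Matrix.mul_apply]
  rw [sum_step' _ (fun (y : Y.T) (c : ℕ) => if X.step.e p = c then
      (if c = Z.step.e q then M (par p) y * N y (par q) else 0) else 0)]
  swap
  · intro r
    simp only [J]
    split_ifs <;> simp
  simp only [J, Matrix.mul_apply]
  rw [show (if X.step.e p = Z.step.e q then ∑ y, M (par p) y * N y (par q) else 0) =
    ∑ y, if X.step.e p = Z.step.e q then M (par p) y * N y (par q) else 0 by
      split_ifs <;> simp]
  · refine Finset.sum_congr rfl fun y _ => ?_
    by_cases h0 : M (par p) y = 0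
    · simp [h0]
    · have := hM _ _ h0
      have h2 := e_mem p
      rw [this] at h2
      simp [h2]

lemma J_one {X : Gr} : J (1 : Matrix X.T X.T ℂ) = 1 := by
  ext p q
  simp only [J, Matrix.one_apply]
  by_cases h : p = q
  · subst h; simp
  · rw [if_neg h]
    split_ifs with h1 h2
    · exact absurd (step_ext h2 h1) h
    · rfl
    · rfl

/-- the algebra of block matrices -/
def A (X : Gr) : Subalgebra ℂ (Matrix X.T X.T ℂ) where
  carrier := {M | Blk M}
  mul_mem' := by
    intro M N hM hN s t h
    rw [Matrix.mul_apply] at h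
    obtain ⟨r, _, hr⟩ := Finset.exists_ne_zero_of_sum_ne_zero h
    exact (hM _ _ (left_ne_zero_of_mul hr)).trans (hN _ _ (right_ne_zero_of_mul hr))
  add_mem' := by
    intro M N hM hN s t h
    by_cases h0 : M s t = 0
    · refine hN _ _ ?_
      intro h1
      exact h (by simp [h0, h1])
    · exact hM _ _ h0
  algebraMap_mem' := by
    intro c s t h
    rw [Matrix.algebraMap_matrix_apply] at h
    by_contra h'
    exact h (if_neg (fun hst => h' (by rw [hst])))

/-- `J` as an algebra homomorphism -/
def JA (X : Gr) : A X →ₐ[ℂ] A X.step :=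
  AlgHom.ofLinearMap
    { toFun := fun M => ⟨J M.1, J_blk _⟩
      map_add' := by
        intro M N
        ext p q
        simp only [J, Subalgebra.coe_add, Matrix.add_apply]
        split_ifs <;> simp
      map_smul' := by
        intro c M
        ext p q
        simp [J, Matrix.smul_apply] }
    (Subtype.ext J_one) (fun M N => Subtype.ext (J_mul M.1 N.1 M.2))

lemma JA_val {X : Gr} (M : A X) : (JA X M).1 = J M.1 := rfl

variable (U : ℕ → ℂ)

/-- creation of two steps -/
noncomputable def cup (X : Gr) : Matrix X.step.step.T X.T ℂ := fun p t =>
  if par (par p) = t ∧ X.step.step.e p = X.e t then U (X.step.e (par p) + 1) else 0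

/-- annihilation of two steps -/
noncomputable def cap (X : Gr) : Matrix X.T X.step.step.T ℂ := fun t p =>
  if par (par p) = t ∧ X.step.step.e p = X.e t then (U (X.e t + 1))⁻¹ else 0

lemma cup_blk (X : Gr) : Blk (cup U X) := by
  intro s t h
  by_contra h'
  exact h (if_neg (fun h2 => h' h2.2))

lemma cap_blk (X : Gr) : Blk (cap U X) := by
  intro s t h
  by_contra h'
  exact h (if_neg (fun h2 => h' h2.2.symm))

lemma cap_cup (X : Gr) (d : ℂ) (hU : ∀ x : X.T, U (X.e x + 1) ≠ 0) (h0 : U 0 = 0)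
    (hrec : ∀ k, U (k + 2) = d * U (k + 1) - U k) :
    cap U X * cup U X = d • (1 : Matrix X.T X.T ℂ) := by
  have hs : ∀ a, ∑ b ∈ nbr a, U (b + 1) = d * U (a + 1) := by
    intro a
    unfold nbr
    split_ifs with h
    · subst h
      have := hrec 0
      simp only [h0, sub_zero, zero_add] at this
      simpa using this
    · obtain ⟨k, rfl⟩ : ∃ k, a = k + 1 := ⟨a - 1, by omega⟩
      rw [Finset.sum_pair (by omega)]
      have := hrec (k + 1)
      simp only [Nat.add_sub_cancel]
      linear_combination this
  ext s t
  rw [Matrix.mul_apply]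
  rw [sum_step' _ (fun (y : X.step.T) (c : ℕ) => if c = X.e t then
        (if par y = s then (if s = t then (U (X.e t + 1))⁻¹ * U (X.step.e y + 1) else 0) else 0)
        else 0)]
  swap
  · intro p
    clear hU hrec hs
    simp only [cap, cup]
    by_cases hst : s = t
    · subst hst
      by_cases h1 : par (par p) = s <;> by_cases h2 : X.step.step.e p = X.e s <;> simp [h1, h2]
    · by_cases h1 : par (par p) = s
      · have : ¬ par (par p) = t := by rw [h1]; exact hst
        simp [this, hst]
      · simp [h1]
  rw [sum_step' _ (fun (x : X.T) (c : ℕ) => if x = s then (if s = t then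
        (U (X.e t + 1))⁻¹ * U (c + 1) else 0) else 0)]
  swap
  · intro y
    have := e_mem' y
    simp only [Finset.sum_ite_eq']
    by_cases h1 : par y = s
    · by_cases h2 : s = t
      · rw [h1, h2] at this
        simp [h1, h2, this]
      · simp [h1, h2]
    · simp [h1]
  rw [Finset.sum_eq_single s]
  · by_cases hst : s = t
    · subst hst
      simp only [if_true, ← Finset.mul_sum, hs]
      simp
      field_simp [hU s]
    · simp [hst]
  · intro b _ hb
    simp [hb]
  · simp

lemma zig (X : Gr) (hU : ∀ x : X.T, U (X.e x + 1) ≠ 0) :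
    J (cap U X) * cup U X.step = 1 := by
  ext s t
  rw [Matrix.mul_apply, Matrix.one_apply]
  split_ifs with h
  · subst h
    rw [Finset.sum_eq_single
      (mk' (mk' s (X.e (par s)) (e_mem' s)) (X.step.e s) (mem_mk (e_mem s)) : X.step.step.step.T)]
    · simp [J, cap, cup, par_mk, e_mk, hU]
    · intro b _ hb
      by_contra hne
      apply hb
      have h1 := left_ne_zero_of_mul hne
      have h2 := right_ne_zero_of_mul hne
      simp only [J, cap, cup, ne_eq, ite_eq_right_iff, Classical.not_imp] at h1 h2
      apply step_ext
      · apply step_ext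
        · exact h2.1.1
        · exact h1.2.1.2
      · exact h2.1.2
    · simp
  · apply Finset.sum_eq_zero
    intro b _
    by_contra hne
    have h1 := left_ne_zero_of_mul hne
    have h2 := right_ne_zero_of_mul hne
    simp only [J, cap, cup, ne_eq, ite_eq_right_iff, Classical.not_imp] at h1 h2
    apply h
    apply step_ext
    · rw [← h1.2.1.1, h2.1.1]
    · rw [h1.1, h2.1.2]

lemma zag (X : Gr) (hU : ∀ x : X.step.T, U (X.step.e x + 1) ≠ 0) :
    cap U X.step * J (cup U X) = 1 := by
  ext s t
  rw [Matrix.mul_apply, Matrix.one_apply]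
  split_ifs with h
  · subst h
    rw [Finset.sum_eq_single
      (mk' (mk' s (X.e (par s)) (e_mem' s)) (X.step.e s) (mem_mk (e_mem s)) : X.step.step.step.T)]
    · simp [J, cap, cup, par_mk, e_mk, hU]
    · intro b _ hb
      by_contra hne
      apply hb
      have h1 := left_ne_zero_of_mul hne
      have h2 := right_ne_zero_of_mul hne
      simp only [J, cap, cup, ne_eq, ite_eq_right_iff, Classical.not_imp] at h1 h2
      apply step_ext
      · apply step_ext
        · exact h1.1.1
        · exact h2.2.1.2
      · exact h1.1.2
    · simp
  · apply Finset.sum_eq_zero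
    intro b _
    by_contra hne
    have h1 := left_ne_zero_of_mul hne
    have h2 := right_ne_zero_of_mul hne
    simp only [J, cap, cup, ne_eq, ite_eq_right_iff, Classical.not_imp] at h1 h2
    apply h
    apply step_ext
    · rw [← h2.2.1.1, h1.1.1]
    · rw [← h2.1, h1.1.2]

lemma JJ_cup (X : Gr) (M : Matrix X.T X.T ℂ) (hM : Blk M) : J (J M) * cup U X = cup U X * M := by
  ext p t
  rw [Matrix.mul_apply, Matrix.mul_apply]
  rw [Finset.sum_eq_single (par (par p))]
  · by_cases h : M (par (par p)) t = 0
    · rw [h, mul_zero]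
      apply Finset.sum_eq_zero
      intro q _
      simp only [J, cup]
      by_cases h3 : par (par q) = t
      · simp [h3, h]
      · simp [h3]
    · have h1 := hM _ _ h
      have h2 := e_mem (par p)
      rw [h1] at h2
      rw [Finset.sum_eq_single (mk' (mk' t (X.step.e (par p)) h2) (X.step.step.e p) (mem_mk (e_mem p)))]
      · simp only [J, cup, par_mk, e_mk]
        rw [h1]
        simp only [if_true, true_and]
        split_ifs <;> ring
      · intro q _ hq
        by_contra hne
        apply hq
        have h3 := left_ne_zero_of_mul hne
        have h4 := right_ne_zero_of_mul hne
        simp only [J, cup, ne_eq, ite_eq_right_iff, Classical.not_imp] at h3 h4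
        apply step_ext
        · apply step_ext
          · exact h4.1.1
          · exact h3.2.1.symm
        · exact h3.1.symm
      · simp
  · intro b _ hb
    simp [cup, hb.symm]
  · simp

lemma cap_JJ (X : Gr) (M : Matrix X.T X.T ℂ) (hM : Blk M) : cap U X * J (J M) = M * cap U X := by
  ext t p
  rw [Matrix.mul_apply, Matrix.mul_apply]
  rw [Finset.sum_eq_single (f := fun j => M t j * cap U X j p) (par (par p))]
  · by_cases h : M t (par (par p)) = 0
    · rw [h, zero_mul]
      apply Finset.sum_eq_zero
      intro q _
      simp only [J, cap]
      by_cases h3 : par (par q) = t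
      · simp [h3, h]
      · simp [h3]
    · have h1 := hM _ _ h
      have h2 := e_mem (par p)
      rw [← h1] at h2
      rw [Finset.sum_eq_single (mk' (mk' t (X.step.e (par p)) h2) (X.step.step.e p) (mem_mk (e_mem p)))]
      · simp only [J, cap, par_mk, e_mk]
        rw [h1]
        simp only [if_true, true_and]
        split_ifs <;> ring
      · intro q _ hq
        by_contra hne
        apply hq
        have h3 := left_ne_zero_of_mul hne
        have h4 := right_ne_zero_of_mul hne
        simp only [J, cap, ne_eq, ite_eq_right_iff, Classical.not_imp] at h3 h4
        apply step_ext
        · apply step_ext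
          · exact h3.1.1
          · exact h4.2.1
        · exact h4.1
      · simp
  · intro b _ hb
    simp [cap, hb.symm]
  · simp

/-- the path-model generator -/
noncomputable def eA (X : Gr) : A X.step.step :=
  ⟨cup U X * cap U X, by
    intro s t h
    rw [Matrix.mul_apply] at h
    obtain ⟨r, _, hr⟩ := Finset.exists_ne_zero_of_sum_ne_zero h
    exact (cup_blk U X _ _ (left_ne_zero_of_mul hr)).trans
      (cap_blk U X _ _ (right_ne_zero_of_mul hr))⟩

lemma eA_sq (X : Gr) (d : ℂ) (hU : ∀ x : X.T, U (X.e x + 1) ≠ 0) (h0 : U 0 = 0)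
    (hrec : ∀ k, U (k + 2) = d * U (k + 1) - U k) : eA U X * eA U X = d • eA U X := by
  apply Subtype.ext
  change cup U X * cap U X * (cup U X * cap U X) = d • (cup U X * cap U X)
  rw [Matrix.mul_assoc, ← Matrix.mul_assoc (cap U X), cap_cup U X d hU h0 hrec]
  simp

lemma eA_comm (X : Gr) (M : A X) : eA U X * JA _ (JA _ M) = JA _ (JA _ M) * eA U X := by
  apply Subtype.ext
  change cup U X * cap U X * J (J M.1) = J (J M.1) * (cup U X * cap U X)
  rw [Matrix.mul_assoc, cap_JJ U X _ M.2, ← Matrix.mul_assoc, ← Matrix.mul_assoc, JJ_cup U X _ M.2]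

lemma eA_hook1 (X : Gr) (hU : ∀ x : X.T, U (X.e x + 1) ≠ 0)
    (hU' : ∀ x : X.step.T, U (X.step.e x + 1) ≠ 0) :
    JA _ (eA U X) * eA U X.step * JA _ (eA U X) = JA _ (eA U X) := by
  apply Subtype.ext
  change J (cup U X * cap U X) * (cup U X.step * cap U X.step) * J (cup U X * cap U X) =
    J (cup U X * cap U X)
  rw [J_mul _ _ (cup_blk U X)]
  calc _ = J (cup U X) * (J (cap U X) * cup U X.step) * (cap U X.step * J (cup U X)) *
        J (cap U X) := by simp only [Matrix.mul_assoc]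
    _ = _ := by rw [zig U X hU, zag U X hU']; simp

lemma eA_hook2 (X : Gr) (hU : ∀ x : X.T, U (X.e x + 1) ≠ 0)
    (hU' : ∀ x : X.step.T, U (X.step.e x + 1) ≠ 0) :
    eA U X.step * JA _ (eA U X) * eA U X.step = eA U X.step := by
  apply Subtype.ext
  change (cup U X.step * cap U X.step) * J (cup U X * cap U X) * (cup U X.step * cap U X.step) =
    cup U X.step * cap U X.step
  rw [J_mul _ _ (cup_blk U X)]
  calc _ = cup U X.step * (cap U X.step * J (cup U X)) * (J (cap U X) * cup U X.step) *
        cap U X.step := by simp only [Matrix.mul_assoc]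
    _ = _ := by rw [zig U X hU, zag U X hU']; simp

/-! ### Paths and matrix units -/

/-- paths of length `n` starting at `0` -/
def Path : ℕ → Gr
  | 0 => ⟨Unit, inferInstance, inferInstance, fun _ => 0⟩
  | n + 1 => (Path n).step

lemma Path_le (n : ℕ) (x : (Path n).T) : (Path n).e x ≤ n := by
  induction n with
  | zero => exact le_rfl
  | succ n ih =>
    have h1 := e_mem (X := Path n) x
    have h2 := ih (par x)
    rw [mem_nbr] at h1
    change (Path n).step.e x ≤ n + 1
    omega

lemma Path_mod (n : ℕ) (x : (Path n).T) : (Path n).e x % 2 = n % 2 := by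
  induction n with
  | zero => rfl
  | succ n ih =>
    have h1 := e_mem (X := Path n) x
    have h2 := ih (par x)
    rw [mem_nbr] at h1
    change (Path n).step.e x % 2 = (n + 1) % 2
    omega

lemma Path_top (n : ℕ) (x y : (Path n).T) (hx : (Path n).e x = n) (hy : (Path n).e y = n) :
    x = y := by
  induction n with
  | zero => rfl
  | succ n ih =>
    have h1 := e_mem (X := Path n) x
    have h2 := Path_le n (par x)
    have h3 := e_mem (X := Path n) y
    have h4 := Path_le n (par y)
    rw [mem_nbr] at h1 h3
    change (Path n).step.e x = n + 1 at hx
    change (Path n).step.e y = n + 1 at hy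
    exact step_ext (ih _ _ (by omega) (by omega)) (hx.trans hy.symm)

lemma Path_ex (n a : ℕ) (ha : a ≤ n) (hm : a % 2 = n % 2) : ∃ x : (Path n).T, (Path n).e x = a := by
  induction n generalizing a with
  | zero => exact ⟨(), by change 0 = a; omega⟩
  | succ n ih =>
    rcases Nat.eq_zero_or_pos a with h | h
    · subst h
      obtain ⟨x, hx⟩ := ih 1 (by omega) (by omega)
      exact ⟨mk' x 0 (by rw [mem_nbr]; omega), rfl⟩
    · obtain ⟨x, hx⟩ := ih (a - 1) (by omega) (by omega)
      exact ⟨mk' x a (by rw [mem_nbr]; omega), rfl⟩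

lemma Path_good (n : ℕ) (x : (Path (n + 2)).T) :
    (Path (n + 2)).e x = n + 2 ∨ ∃ r : (Path n).T, (Path n).e r = (Path (n + 2)).e x := by
  by_cases h : (Path (n + 2)).e x = n + 2
  · exact Or.inl h
  · right
    have h1 := Path_le _ x
    have h2 := Path_mod _ x
    exact Path_ex n _ (by omega) (by omega)

/-- matrix units -/
def E (X : Gr) (s t : X.T) : A X :=
  ⟨fun x y => if x = s ∧ y = t ∧ X.e s = X.e t then 1 else 0, by
    intro x y h
    by_contra h'
    apply h
    apply if_neg
    rintro ⟨rfl, rfl, h2⟩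
    exact h' h2⟩

lemma E_apply {X : Gr} (s t x y : X.T) :
    (E X s t).1 x y = if x = s ∧ y = t ∧ X.e s = X.e t then 1 else 0 := rfl

lemma E_zero {X : Gr} (s t : X.T) (h : X.e s ≠ X.e t) : E X s t = 0 := by
  apply Subtype.ext
  ext x y
  rw [E_apply, if_neg (fun h' => h h'.2.2)]
  rfl

lemma A_sum {X : Gr} (M : A X) : M = ∑ s, ∑ t, M.1 s t • E X s t := by
  apply Subtype.ext
  ext x y
  simp only [AddSubmonoidClass.coe_finsetSum, SetLike.val_smul, Matrix.sum_apply,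
    Matrix.smul_apply]
  rw [Finset.sum_eq_single x, Finset.sum_eq_single y]
  · rw [E_apply]
    by_cases h : M.1 x y = 0
    · simp [h]
    · simp [M.2 _ _ h]
  · intro t _ ht
    rw [E_apply, if_neg (fun h => ht h.2.1.symm), smul_zero]
  · simp
  · intro s _ hs
    apply Finset.sum_eq_zero
    intro t _
    rw [E_apply, if_neg (fun h => hs h.1.symm), smul_zero]
  · simp

lemma one_sum {X : Gr} : (1 : A X) = ∑ s, E X s s := by
  apply Subtype.ext
  ext x y
  simp only [AddSubmonoidClass.coe_finsetSum, Matrix.sum_apply]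
  rw [Finset.sum_eq_single x]
  · rw [E_apply]
    change (1 : Matrix X.T X.T ℂ) x y = _
    rw [Matrix.one_apply]
    by_cases h : x = y
    · simp [h]
    · simp [h, Ne.symm h]
  · intro s _ hs
    rw [E_apply, if_neg (fun h => hs h.1.symm)]
  · simp

lemma mem_par {X : Gr} {r : X.T} {u : X.step.T} (h : X.e r = X.e (par u)) :
    X.step.e u ∈ nbr (X.e r) := by
  rw [h]; exact e_mem u

lemma JE_zero {X : Gr} (r t : X.T) (u v : X.step.T) (h : par u ≠ t) :
    JA X (E X r t) * E X.step u v = 0 := by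
  apply Subtype.ext
  ext x y
  change (J (E X r t).1 * (E X.step u v).1) x y = 0
  rw [Matrix.mul_apply]
  apply Finset.sum_eq_zero
  intro p _
  by_contra hne
  have h1 := left_ne_zero_of_mul hne
  have h2 := right_ne_zero_of_mul hne
  simp only [J, E_apply, ne_eq, ite_eq_right_iff, Classical.not_imp] at h1 h2
  apply h
  rw [← h1.2.1.2.1, h2.1.1]

lemma JE_mul {X : Gr} (r : X.T) (u v : X.step.T) (h : X.e r = X.e (par u)) :
    JA X (E X r (par u)) * E X.step u v = E X.step (mk' r (X.step.e u) (mem_par h)) v := by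
  apply Subtype.ext
  ext x y
  change (J (E X r (par u)).1 * (E X.step u v).1) x y = _
  rw [Matrix.mul_apply, Finset.sum_eq_single u]
  · simp only [J, E_apply, e_mk]
    by_cases h1 : x = mk' r (X.step.e u) (mem_par h)
    · subst h1
      simp [e_mk, par_mk, h]
    · have : ¬ (X.step.e x = X.step.e u ∧ par x = r) := by
        rintro ⟨h2, h3⟩
        exact h1 (step_ext h3 h2)
      by_cases h2 : X.step.e x = X.step.e u <;> by_cases h3 : par x = r <;> simp_all
  · intro p _ hp
    rw [E_apply, if_neg (fun h => hp h.1), mul_zero]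
  · simp

lemma E_JE {X : Gr} (r : X.T) (s t : X.step.T) (h : X.e r = X.e (par t)) :
    E X.step s (mk' r (X.step.e t) (mem_par h)) * JA X (E X r (par t)) = E X.step s t := by
  apply Subtype.ext
  ext x y
  change ((E X.step s (mk' r (X.step.e t) (mem_par h))).1 * J (E X r (par t)).1) x y = _
  rw [Matrix.mul_apply, Finset.sum_eq_single (mk' r (X.step.e t) (mem_par h))]
  · simp only [J, E_apply, e_mk, par_mk]
    by_cases h1 : y = t
    · subst h1
      simp [h]
    · have : ¬ (X.step.e t = X.step.e y ∧ par y = par t) := by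
        rintro ⟨h2, h3⟩
        exact h1 (step_ext h3 h2.symm)
      by_cases h2 : X.step.e t = X.step.e y <;> by_cases h3 : par y = par t <;> simp_all
  · intro p _ hp
    rw [E_apply, if_neg (fun h => hp h.2.1), zero_mul]
  · simp

lemma JE_cup {X : Gr} (s t : X.step.T) (hst : X.step.e s = X.step.e t) (x : X.step.step.T)
    (r : X.T) : (J (E X.step s t).1 * cup U X) x r =
      if par x = s ∧ r = par t ∧ X.step.step.e x = X.e r then U (X.step.e t + 1) else 0 := by
  rw [Matrix.mul_apply]
  split_ifs with h
  · obtain ⟨h1, h2, h3⟩ := h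
    rw [Finset.sum_eq_single (mk' t (X.step.step.e x) (by rw [h3, h2]; exact e_mem' t))]
    · simp only [J, cup, par_mk, e_mk, E_apply]
      simp [h1, h2, h3, hst]
    · intro p _ hp
      by_contra hne
      have h4 := left_ne_zero_of_mul hne
      simp only [J, E_apply, ne_eq, ite_eq_right_iff, Classical.not_imp] at h4
      exact hp (step_ext h4.2.1.2.1 h4.1.symm)
    · simp
  · apply Finset.sum_eq_zero
    intro p _
    by_contra hne
    have h1 := left_ne_zero_of_mul hne
    have h2 := right_ne_zero_of_mul hne
    simp only [J, cup, E_apply, ne_eq, ite_eq_right_iff, Classical.not_imp] at h1 h2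
    apply h
    refine ⟨h1.2.1.1, ?_, h1.1.trans h2.1.2⟩
    rw [← h2.1.1, h1.2.1.2.1]

lemma cap_JE {X : Gr} (u v : X.step.T) (huv : X.step.e u = X.step.e v) (y : X.step.step.T)
    (r : X.T) : (cap U X * J (E X.step u v).1) r y =
      if par y = v ∧ r = par u ∧ X.step.step.e y = X.e r then (U (X.e r + 1))⁻¹ else 0 := by
  rw [Matrix.mul_apply]
  split_ifs with h
  · obtain ⟨h1, h2, h3⟩ := h
    rw [Finset.sum_eq_single (mk' u (X.step.step.e y) (by rw [h3, h2]; exact e_mem' u))]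
    · simp only [J, cap, par_mk, e_mk, E_apply]
      simp [h1, h2, h3, huv]
    · intro p _ hp
      by_contra hne
      have h4 := right_ne_zero_of_mul hne
      simp only [J, E_apply, ne_eq, ite_eq_right_iff, Classical.not_imp] at h4
      exact hp (step_ext h4.2.1.1 h4.1)
    · simp
  · apply Finset.sum_eq_zero
    intro p _
    by_contra hne
    have h1 := left_ne_zero_of_mul hne
    have h2 := right_ne_zero_of_mul hne
    simp only [J, cap, E_apply, ne_eq, ite_eq_right_iff, Classical.not_imp] at h1 h2
    apply h
    refine ⟨h2.2.1.2.1, ?_, h2.1.symm.trans h1.1.2⟩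
    rw [← h1.1.1, h2.2.1.1]

lemma JEeJE {X : Gr} (s t u v : X.step.T) (hst : X.step.e s = X.step.e t)
    (huv : X.step.e u = X.step.e v) (h : par t = par u) (x y : X.step.step.T)
    (hxs : par x = s) (hyv : par y = v) (hx : X.step.step.e x = X.e (par t))
    (hy : X.step.step.e y = X.e (par t)) :
    JA _ (E X.step s t) * eA U X * JA _ (E X.step u v) =
      (U (X.step.e t + 1) * (U (X.e (par t) + 1))⁻¹) • E X.step.step x y := by
  apply Subtype.ext
  ext p q
  change (J (E X.step s t).1 * (cup U X * cap U X) * J (E X.step u v).1) p q =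
    (U (X.step.e t + 1) * (U (X.e (par t) + 1))⁻¹) * (E X.step.step x y).1 p q
  rw [← Matrix.mul_assoc, Matrix.mul_assoc, Matrix.mul_apply, Finset.sum_eq_single (par t)]
  · rw [JE_cup U s t hst, cap_JE U u v huv, E_apply]
    have e1 : (p = x) ↔ (par p = s ∧ X.step.step.e p = X.e (par t)) := by
      constructor
      · rintro rfl; exact ⟨hxs, hx⟩
      · rintro ⟨h1, h2⟩
        exact step_ext (h1.trans hxs.symm) (h2.trans hx.symm)
    have e2 : (q = y) ↔ (par q = v ∧ X.step.step.e q = X.e (par t)) := by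
      constructor
      · rintro rfl; exact ⟨hyv, hy⟩
      · rintro ⟨h1, h2⟩
        exact step_ext (h1.trans hyv.symm) (h2.trans hy.symm)
    simp only [e1, e2, hx, hy]
    by_cases h1 : par p = s ∧ X.step.step.e p = X.e (par t) <;>
    by_cases h2 : par q = v ∧ X.step.step.e q = X.e (par t)
    · simp [h1, h2, h]
    · simp only [h, true_and] at *; simp [h2]
    · simp only [h, true_and] at *; simp [h1]
    · simp only [h, true_and] at *; simp [h1]
  · intro r _ hr
    rw [JE_cup U s t hst, if_neg (fun h => hr h.2.1), zero_mul]
  · simp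

/-- `JA` for paths -/
def JP (n : ℕ) : A (Path n) →ₐ[ℂ] A (Path (n + 1)) := JA (Path n)

/-- `eA` for paths -/
noncomputable def eP (n : ℕ) : A (Path (n + 2)) := eA U (Path n)

/-- the path-model generators -/
noncomputable def H : (n : ℕ) → ℕ → A (Path n)
  | 0, _ => 0
  | 1, _ => 0
  | n + 2, i => if i = n then eP U n else JP (n + 1) (H (n + 1) i)

lemma H_last (n : ℕ) : H U (n + 2) n = eP U n := by simp [H]

lemma H_lt (n i : ℕ) (hi : i < n - 1) : H U (n + 1) i = JP n (H U n i) := by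
  obtain ⟨k, rfl⟩ : ∃ k, n = k + 1 := ⟨n - 1, by omega⟩
  rw [H, if_neg (by omega)]

lemma H_rels (d : ℂ) (h0 : U 0 = 0) (hrec : ∀ k, U (k + 2) = d * U (k + 1) - U k) (n : ℕ)
    (hU : ∀ k, 1 ≤ k → k ≤ n → U k ≠ 0) : Rels d (n - 1) (H U n) := by
  induction n with
  | zero => constructor <;> intros <;> omega
  | succ n ih =>
    have ih := ih (fun k h1 h2 => hU k h1 (by omega))
    have hne : ∀ m, m < n + 1 → ∀ x : (Path m).T, U ((Path m).e x + 1) ≠ 0 := by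
      intro m hm x
      have := Path_le m x
      exact hU _ (by omega) (by omega)
    constructor
    · intro i hi
      by_cases h : i < n - 1
      · rw [H_lt U n i h, ← map_mul, ih.sq i h, map_smul]
      · obtain ⟨k, rfl⟩ : ∃ k, n = k + 1 := ⟨n - 1, by omega⟩
        obtain rfl : i = k := by omega
        rw [H_last]
        exact eA_sq U (Path i) d (hne i (by omega)) h0 hrec
    · intro i j hi hj hij
      by_cases h : j < n - 1
      · rw [H_lt U n i (by omega), H_lt U n j h, ← map_mul, ih.comm i j (by omega) h hij, map_mul]
      · obtain ⟨k, rfl⟩ : ∃ k, n = k + 1 := ⟨n - 1, by omega⟩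
        obtain rfl : j = k := by omega
        rw [H_last, H_lt U _ i (by omega), H_lt U _ i (by omega)]
        exact (eA_comm U (Path j) (H U j i)).symm
    · intro i hi
      by_cases h : i + 1 < n - 1
      · rw [H_lt U n i (by omega), H_lt U n (i + 1) h, ← map_mul, ← map_mul, ih.hook1 i (by omega)]
      · obtain ⟨k, rfl⟩ : ∃ k, n = k + 2 := ⟨n - 2, by omega⟩
        obtain rfl : i = k := by omega
        rw [H_last U (i + 1), H_lt U _ i (by omega), H_last U i]
        exact eA_hook1 U (Path i) (hne i (by omega)) (hne (i + 1) (by omega))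
    · intro i hi
      by_cases h : i + 1 < n - 1
      · rw [H_lt U n i (by omega), H_lt U n (i + 1) h, ← map_mul, ← map_mul, ih.hook2 i (by omega)]
      · obtain ⟨k, rfl⟩ : ∃ k, n = k + 2 := ⟨n - 2, by omega⟩
        obtain rfl : i = k := by omega
        rw [H_last U (i + 1), H_lt U _ i (by omega), H_last U i]
        exact eA_hook2 U (Path i) (hne i (by omega)) (hne (i + 1) (by omega))

/-! ### The induction step -/

lemma mul_blk {X Y Z : Gr} {M : Matrix X.T Y.T ℂ} {N : Matrix Y.T Z.T ℂ} (hM : Blk M)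
    (hN : Blk N) : Blk (M * N) := by
  intro s t h
  rw [Matrix.mul_apply] at h
  obtain ⟨r, _, hr⟩ := Finset.exists_ne_zero_of_sum_ne_zero h
  exact (hM _ _ (left_ne_zero_of_mul hr)).trans (hN _ _ (right_ne_zero_of_mul hr))

theorem main_step (d : ℂ) (n : ℕ) (X : Gr) (φ0 : TL d n →ₐ[ℂ] A X)
    (φ1 : TL d (n + 1) →ₐ[ℂ] A X.step) (φ2 : TL d (n + 2) →ₐ[ℂ] A X.step.step)
    (c01 : ∀ x, φ1 (iota d n x) = JA _ (φ0 x)) (c12 : ∀ x, φ2 (iota d (n + 1) x) = JA _ (φ1 x))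
    (hg : φ2 (g d (n + 2) n) = eA U X)
    (hU0 : ∀ x : X.T, U (X.e x + 1) ≠ 0) (hU1 : ∀ x : X.step.T, U (X.step.e x + 1) ≠ 0)
    (htop : ∃ x : X.step.step.T, (∀ r, X.e r ≠ X.step.step.e x) ∧
      ∀ y, (∃ r, X.e r = X.step.step.e y) ∨ y = x)
    (b0 : Function.Surjective φ0) (b1 : Function.Bijective φ1) : Function.Bijective φ2 := by
  choose k0 hk0 using fun r t => b0 (E X r t)
  choose k1 hk1 using fun s t => b1.2 (E X.step s t)
  have F0 : ∀ s t, X.step.e s ≠ X.step.e t → k1 s t = 0 := by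
    intro s t h
    apply b1.1
    rw [hk1, E_zero _ _ h, map_zero]
  have F1 : ∀ r t u v, par u ≠ t → iota d n (k0 r t) * k1 u v = 0 := by
    intro r t u v h
    apply b1.1
    rw [map_mul, c01, hk0, hk1, JE_zero _ _ _ _ h, map_zero]
  have F2 : ∀ r u v (h : X.e r = X.e (par u)), iota d n (k0 r (par u)) * k1 u v =
      k1 (mk' r (X.step.e u) (mem_par h)) v := by
    intro r u v h
    apply b1.1
    rw [map_mul, c01, hk0, hk1, hk1, JE_mul _ _ _ h]
  have F3 : ∀ r s t (h : X.e r = X.e (par t)),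
      k1 s (mk' r (X.step.e t) (mem_par h)) * iota d n (k0 r (par t)) = k1 s t := by
    intro r s t h
    apply b1.1
    rw [map_mul, c01, hk0, hk1, hk1, E_JE _ _ _ h]
  set z : X.step.T → X.step.T → X.step.T → X.step.T → TL d (n + 2) := fun s t u v =>
    iota d (n + 1) (k1 s t) * g d (n + 2) n * iota d (n + 1) (k1 u v) with hz
  have Zm : ∀ r s t u v (h : X.e r = X.e (par t)), z s t u v =
      iota d (n + 1) (k1 s (mk' r (X.step.e t) (mem_par h))) * g d (n + 2) n *
        iota d (n + 1) (iota d n (k0 r (par t)) * k1 u v) := by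
    intro r s t u v h
    simp only [hz]
    rw [← F3 r s t h, map_mul, mul_assoc (iota d (n + 1) (k1 s _)), ← g_comm, map_mul]
    simp only [mul_assoc]
  have Z0 : ∀ s t u v, par t ≠ par u → z s t u v = 0 := by
    intro s t u v h
    rw [Zm (par t) s t u v rfl, F1 _ _ _ _ h.symm, map_zero, mul_zero]
  have Z1 : ∀ r s t u v (h : X.e r = X.e (par t)) (h' : X.e r = X.e (par u)), par t = par u →
      z s t u v = z s (mk' r (X.step.e t) (mem_par h)) (mk' r (X.step.e u) (mem_par h')) v := by
    intro r s t u v h h' htu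
    rw [Zm r s t u v h, htu, F2 _ _ _ h']
  have Zφ : ∀ s t u v, X.step.e s = X.step.e t → X.step.e u = X.step.e v → par t = par u →
      ∀ x y : X.step.step.T, par x = s → par y = v → X.step.step.e x = X.e (par t) →
      X.step.step.e y = X.e (par t) →
      φ2 (z s t u v) = (U (X.step.e t + 1) * (U (X.e (par t) + 1))⁻¹) • E X.step.step x y := by
    intro s t u v hst huv htu x y hx hy hx' hy'
    rw [← JEeJE U s t u v hst huv htu x y hx hy hx' hy', hz]
    simp only [map_mul, c12, hg, hk1]
  -- normalised lifts of the matrix units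
  have hXf : ∀ x y : X.step.step.T, ∃ ξ : TL d (n + 2), (∃ r, X.e r = X.step.step.e x) →
      X.step.step.e x = X.step.step.e y →
      (φ2 ξ = E X.step.step x y ∧ ∀ s t u v, X.step.e s = X.step.e t → X.step.e u = X.step.e v →
        par t = par u → par x = s → par y = v → X.step.step.e x = X.e (par t) →
        z s t u v = (U (X.step.e t + 1) * (U (X.e (par t) + 1))⁻¹) • ξ) := by
    intro x y
    by_cases h : (∃ r, X.e r = X.step.step.e x) ∧ X.step.step.e x = X.step.step.e y
    · obtain ⟨⟨r, hr⟩, hxy⟩ := h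
      have hbx : X.step.e (par x) ∈ nbr (X.e r) := by rw [hr]; exact e_mem' x
      have hby : X.step.e (par y) ∈ nbr (X.e r) := by rw [hr, hxy]; exact e_mem' y
      have hne : U (X.step.e (par x) + 1) * (U (X.e r + 1))⁻¹ ≠ 0 :=
        mul_ne_zero (hU1 _) (inv_ne_zero (hU0 _))
      refine ⟨(U (X.step.e (par x) + 1) * (U (X.e r + 1))⁻¹)⁻¹ •
        z (par x) (mk' r _ hbx) (mk' r _ hby) (par y), fun _ _ => ⟨?_, ?_⟩⟩
      · rw [map_smul, Zφ (par x) (mk' r _ hbx) (mk' r _ hby) (par y) rfl rfl rfl x y rfl rfl hr.symm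
          (hxy.symm.trans hr.symm), smul_smul, par_mk, e_mk, inv_mul_cancel₀ hne, one_smul]
      · intro s t u v hst huv htu hxs hyv hxt
        have e1 : X.e r = X.e (par t) := hr.trans hxt
        have e2 : X.e r = X.e (par u) := by rw [e1, htu]
        rw [Z1 r s t u v e1 e2 htu, smul_smul]
        have e3 : X.step.e t = X.step.e (par x) := by rw [hxs, hst]
        have e4 : X.step.e u = X.step.e (par y) := by rw [hyv, huv]
        have e5 : mk' r (X.step.e t) (mem_par e1) = mk' r _ hbx := step_ext rfl e3
        have e6 : mk' r (X.step.e u) (mem_par e2) = mk' r _ hby := step_ext rfl e4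
        rw [e5, e6, e3, ← e1, mul_inv_cancel₀ hne, one_smul, ← hxs, ← hyv]
    · exact ⟨0, fun h1 h2 => absurd ⟨h1, h2⟩ h⟩
  choose Xf hXf using hXf
  let ρ : A X.step.step →ₗ[ℂ] TL d (n + 2) :=
    { toFun := fun M => ∑ x, ∑ y, M.1 x y • Xf x y
      map_add' := by
        intro M N
        simp only [Subalgebra.coe_add, Matrix.add_apply, add_smul, Finset.sum_add_distrib]
      map_smul' := by
        intro c M
        simp only [SetLike.val_smul, Matrix.smul_apply, smul_eq_mul, mul_smul, Finset.smul_sum,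
          RingHom.id_apply] }
  have hρE : ∀ x y, X.step.step.e x = X.step.step.e y → ρ (E X.step.step x y) = Xf x y := by
    intro x y h
    change ∑ p, ∑ q, (E X.step.step x y).1 p q • Xf p q = _
    rw [Finset.sum_eq_single x, Finset.sum_eq_single y]
    · rw [E_apply, if_pos ⟨rfl, rfl, h⟩, one_smul]
    · intro q _ hq
      rw [E_apply, if_neg (fun h => hq h.2.1), zero_smul]
    · simp
    · intro p _ hp
      apply Finset.sum_eq_zero
      intro q _
      rw [E_apply, if_neg (fun h => hp h.1), zero_smul]
    · simp
  have hρz : ∀ s t u v, ρ (φ2 (z s t u v)) = z s t u v := by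
    intro s t u v
    by_cases hst : X.step.e s = X.step.e t
    swap
    · have : z s t u v = 0 := by simp only [hz]; rw [F0 _ _ hst]; simp
      rw [this]; simp
    by_cases huv : X.step.e u = X.step.e v
    swap
    · have : z s t u v = 0 := by simp only [hz]; rw [F0 _ _ huv]; simp
      rw [this]; simp
    by_cases htu : par t = par u
    swap
    · rw [Z0 _ _ _ _ htu]; simp
    have hx : X.e (par t) ∈ nbr (X.step.e s) := by rw [hst]; exact e_mem' t
    have hy : X.e (par t) ∈ nbr (X.step.e v) := by rw [← huv, htu]; exact e_mem' u
    have hE : X.step.step.e (mk' s _ hx) = X.step.step.e (mk' v _ hy) := rfl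
    have hgd : ∃ r, X.e r = X.step.step.e (mk' s _ hx) := ⟨par t, rfl⟩
    rw [Zφ s t u v hst huv htu (mk' s _ hx) (mk' v _ hy) rfl rfl rfl rfl, map_smul, hρE _ _ hE]
    exact ((hXf _ _ hgd hE).2 s t u v hst huv htu rfl rfl rfl).symm
  have hsum : ∀ x : TL d (n + 1), x = ∑ s, ∑ t, (φ1 x).1 s t • k1 s t := by
    intro x
    apply b1.1
    simp only [map_sum, map_smul, hk1]
    exact A_sum _
  have hρI : ∀ w ∈ I d n, ρ (φ2 w) = w := by
    intro w hw
    induction hw using Submodule.span_induction with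
    | mem w hw =>
      obtain ⟨x, y, rfl⟩ := hw
      have h1 : ∀ s t, ρ (φ2 (iota d (n + 1) (k1 s t) * g d (n + 2) n * iota d (n + 1) y)) =
          iota d (n + 1) (k1 s t) * g d (n + 2) n * iota d (n + 1) y := by
        intro s t
        obtain ⟨c, hc⟩ : ∃ c : X.step.T → X.step.T → ℂ, y = ∑ u, ∑ v, c u v • k1 u v := ⟨_, hsum y⟩
        rw [hc]
        simp only [map_sum, map_smul, Finset.mul_sum, mul_smul_comm]
        refine Finset.sum_congr rfl fun u _ => Finset.sum_congr rfl fun v _ => ?_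
        congr 1
        exact hρz s t u v
      obtain ⟨c, hc⟩ : ∃ c : X.step.T → X.step.T → ℂ, x = ∑ u, ∑ v, c u v • k1 u v := ⟨_, hsum x⟩
      rw [hc]
      simp only [map_sum, map_smul, Finset.sum_mul, smul_mul_assoc]
      refine Finset.sum_congr rfl fun u _ => Finset.sum_congr rfl fun v _ => ?_
      congr 1
      exact h1 u v
    | zero => simp
    | add a b _ _ ha hb => rw [map_add, map_add, ha, hb]
    | smul c a _ ha => rw [map_smul, map_smul, ha]
  obtain ⟨top, htop1, htop2⟩ := htop
  have htopI : ∀ w ∈ I d n, (φ2 w).1 top top = 0 := by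
    intro w hw
    induction hw using Submodule.span_induction with
    | mem w hw =>
      obtain ⟨x, y, rfl⟩ := hw
      rw [map_mul, map_mul, c12, c12, hg]
      change (J (φ1 x).1 * (cup U X * cap U X) * J (φ1 y).1) top top = 0
      rw [← Matrix.mul_assoc, Matrix.mul_assoc, Matrix.mul_apply]
      apply Finset.sum_eq_zero
      intro r _
      by_contra hne
      exact htop1 r (mul_blk (J_blk _) (cup_blk U X) _ _ (left_ne_zero_of_mul hne)).symm
    | zero => rw [map_zero]; rfl
    | add a b _ _ ha hb =>
      rw [map_add, Subalgebra.coe_add, Matrix.add_apply, ha, hb, add_zero]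
    | smul c a _ ha => rw [map_smul, SetLike.val_smul, Matrix.smul_apply, ha, smul_zero]
  constructor
  · rw [injective_iff_map_eq_zero]
    intro x hx
    obtain ⟨c, w, hw, rfl⟩ := TL_span d n x
    have h1 : (φ2 (algebraMap ℂ _ c + w)).1 top top = c := by
      rw [map_add, Subalgebra.coe_add, Matrix.add_apply, htopI w hw, add_zero, AlgHom.commutes]
      change (algebraMap ℂ (Matrix X.step.step.T X.step.step.T ℂ) c) top top = c
      rw [Matrix.algebraMap_matrix_apply, if_pos rfl]
      rfl
    rw [hx] at h1
    have hc : c = 0 := h1.symm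
    subst hc
    rw [map_zero, zero_add] at hx ⊢
    rw [← hρI w hw, hx, map_zero]
  · have hgd : ∀ x y, (∃ r, X.e r = X.step.step.e x) →
        E X.step.step x y ∈ LinearMap.range φ2.toLinearMap := by
      intro x y hr
      by_cases h : X.step.step.e x = X.step.step.e y
      · exact ⟨Xf x y, (hXf x y hr h).1⟩
      · rw [E_zero _ _ h]; exact Submodule.zero_mem _
    have htt : E X.step.step top top ∈ LinearMap.range φ2.toLinearMap := by
      have h1 : (1 : A X.step.step) ∈ LinearMap.range φ2.toLinearMap := ⟨1, map_one φ2⟩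
      rw [one_sum, ← Finset.add_sum_erase _ _ (Finset.mem_univ top)] at h1
      refine (Submodule.add_mem_iff_left _ ?_).1 h1
      refine Submodule.sum_mem _ fun y hy => ?_
      rcases htop2 y with h | h
      · exact hgd y y h
      · exact absurd h (Finset.ne_of_mem_erase hy)
    have hall : ∀ x y, E X.step.step x y ∈ LinearMap.range φ2.toLinearMap := by
      intro x y
      rcases htop2 x with h | h
      · exact hgd x y h
      · rcases htop2 y with h' | h'
        · rw [E_zero]
          · exact Submodule.zero_mem _
          · obtain ⟨r, hr⟩ := h'
            rw [h, ← hr]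
            exact (htop1 r).symm
        · rw [h, h']; exact htt
    intro M
    have : M ∈ LinearMap.range φ2.toLinearMap := by
      rw [A_sum M]
      exact Submodule.sum_mem _ fun x _ => Submodule.sum_mem _ fun y _ =>
        Submodule.smul_mem _ _ (hall x y)
    exact this

/-! ### The isomorphism with the path algebra -/

lemma A_const (X : Gr) (h1 : Subsingleton X.T) (M : A X) (x : X.T) :
    M = algebraMap ℂ (A X) (M.1 x x) := by
  apply Subtype.ext
  ext a b
  obtain rfl := Subsingleton.elim a x
  obtain rfl := Subsingleton.elim b a
  change _ = (algebraMap ℂ (Matrix X.T X.T ℂ) _) b b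
  rw [Matrix.algebraMap_matrix_apply, if_pos rfl]
  rfl

lemma small_bij (d : ℂ) (n : ℕ) (hn : n ≤ 1) (φ : TL d n →ₐ[ℂ] A (Path n)) :
    Function.Bijective φ := by
  have hs : Subsingleton (Path n).T := ⟨fun x y => Path_top n x y
    (by have := Path_le n x; have := Path_mod n x; omega)
    (by have := Path_le n y; have := Path_mod n y; omega)⟩
  obtain ⟨p, -⟩ := Path_ex n n le_rfl rfl
  constructor
  · rw [injective_iff_map_eq_zero]
    intro z hz
    obtain ⟨c, rfl⟩ := TL_one d n hn z
    have h1 : (φ (algebraMap ℂ _ c)).1 p p = c := by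
      rw [AlgHom.commutes]
      change (algebraMap ℂ (Matrix (Path n).T (Path n).T ℂ) c) p p = c
      rw [Matrix.algebraMap_matrix_apply, if_pos rfl]
      rfl
    rw [hz] at h1
    have hc : c = 0 := h1.symm
    rw [hc, map_zero]
  · intro M
    refine ⟨algebraMap ℂ _ (M.1 p p), ?_⟩
    rw [AlgHom.commutes]
    exact (A_const _ hs M p).symm

theorem TL_path (d : ℂ) (h0 : U 0 = 0) (hrec : ∀ k, U (k + 2) = d * U (k + 1) - U k) (n : ℕ)
    (hU : ∀ k, 1 ≤ k → k ≤ n → U k ≠ 0) :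
    ∃ φ : TL d n →ₐ[ℂ] A (Path n), (∀ i < n - 1, φ (g d n i) = H U n i) ∧
      Function.Bijective φ := by
  induction n using Nat.strong_induction_on with
  | _ n ih =>
    obtain ⟨φ, hφ⟩ := TL_lift (H U n) (H_rels U d h0 hrec n hU)
    refine ⟨φ, hφ, ?_⟩
    rcases Nat.lt_or_ge n 2 with h | h
    · exact small_bij d n (by omega) φ
    · obtain ⟨m, rfl⟩ : ∃ m, n = m + 2 := ⟨n - 2, by omega⟩
      obtain ⟨φ0, hφ0, b0⟩ := ih m (by omega) (fun k h1 h2 => hU k h1 (by omega))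
      obtain ⟨φ1, hφ1, b1⟩ := ih (m + 1) (by omega) (fun k h1 h2 => hU k h1 (by omega))
      have c01 : φ1.comp (iota d m) = (JP m).comp φ0 := by
        apply TL_ext
        intro i hi
        rw [AlgHom.comp_apply, AlgHom.comp_apply, iota_g d m i hi, hφ1 i (by omega), hφ0 i hi,
          H_lt U m i hi]
      have c12 : φ.comp (iota d (m + 1)) = (JP (m + 1)).comp φ1 := by
        apply TL_ext
        intro i hi
        rw [AlgHom.comp_apply, AlgHom.comp_apply, iota_g d (m + 1) i hi, hφ i (by omega),
          hφ1 i hi, H_lt U (m + 1) i hi]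
      obtain ⟨top, ht⟩ := Path_ex (m + 2) (m + 2) le_rfl rfl
      refine main_step U d m (Path m) φ0 φ1 φ (fun x => DFunLike.congr_fun c01 x)
        (fun x => DFunLike.congr_fun c12 x) ?_ ?_ ?_ ⟨top, ?_, ?_⟩ b0.2 b1
      · exact (hφ m (by omega)).trans (H_last U m)
      · intro x
        have := Path_le m x
        exact hU _ (by omega) (by omega)
      · intro x
        have : (Path m).step.e x ≤ m + 1 := Path_le (m + 1) x
        exact hU _ (by omega) (by omega)
      · intro r hr
        have h1 := Path_le m r
        have h2 : (Path m).e r = m + 2 := hr.trans ht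
        omega
      · intro y
        rcases Path_good m y with h1 | h1
        · right; exact Path_top (m + 2) y top h1 ht
        · left; exact h1

/-! ### Quantum integers -/

lemma qInt_zero (q : ℂ) : qInt q 0 = 0 := by
  unfold qInt; split_ifs <;> simp

lemma qInt_rec (q : ℂ) (hq : q ≠ 0) (k : ℕ) :
    qInt q (k + 2) = (q + q⁻¹) * qInt q (k + 1) - qInt q k := by
  unfold qInt
  split_ifs with h
  · have h1 : q⁻¹ = q := by
      field_simp; exact h.symm
    rw [h1]
    rcases k with _ | k
    · simp; ring
    · simp only [Nat.add_sub_cancel, show k + 1 + 2 - 1 = k + 2 by omega]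
      rw [pow_succ, pow_succ]
      push_cast
      linear_combination (-(k:ℂ) - 1) * q ^ k * h
  · have h1 : q * q⁻¹ = 1 := mul_inv_cancel₀ hq
    rw [← mul_div_assoc, ← sub_div]
    congr 1
    linear_combination (- q ^ k + q⁻¹ ^ k) * h1

/-! ### Counting paths -/

/-- number of paths of length `n` ending at `a` -/
def cnt (n a : ℕ) : ℕ := Fintype.card {x : (Path n).T // (Path n).e x = a}

lemma cnt_zero_right (n : ℕ) : cnt (n + 1) 0 = cnt n 1 := by
  apply Fintype.card_congr
  refine ⟨fun x => ⟨par (X := Path n) x.1, ?_⟩, fun x => ⟨mk' x.1 0 ?_, rfl⟩, ?_, ?_⟩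
  · have h1 := e_mem (X := Path n) x.1
    rw [mem_nbr] at h1
    have h2 : (Path n).step.e x.1 = 0 := x.2
    omega
  · rw [mem_nbr, x.2]; omega
  · intro x
    apply Subtype.ext
    exact step_ext (X := Path n) rfl x.2.symm
  · intro x; rfl

lemma cnt_succ (n a : ℕ) : cnt (n + 1) (a + 1) = cnt n a + cnt n (a + 2) := by
  unfold cnt
  rw [← Fintype.card_sum]
  symm
  apply Fintype.card_of_bijective (f := fun (z : {x : (Path n).T // (Path n).e x = a} ⊕
    {x : (Path n).T // (Path n).e x = a + 2}) =>
    (Sum.elim (fun x => ⟨mk' x.1 (a + 1) (by rw [mem_nbr, x.2]; omega), rfl⟩)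
      (fun x => ⟨mk' x.1 (a + 1) (by rw [mem_nbr, x.2]; omega), rfl⟩) z :
        {x : (Path (n + 1)).T // (Path (n + 1)).e x = a + 1}))
  constructor
  · rintro (⟨x, hx⟩ | ⟨x, hx⟩) (⟨y, hy⟩ | ⟨y, hy⟩) h
    all_goals
      have h1 : x = y := congrArg (fun z : {x : (Path (n + 1)).T // (Path (n + 1)).e x = a + 1} =>
        par (X := Path n) z.1) h
      subst h1
    · rfl
    · omega
    · omega
    · rfl
  · rintro ⟨x, hx⟩
    have h1 := e_mem (X := Path n) x
    rw [mem_nbr] at h1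
    have h2 : (Path n).step.e x = a + 1 := hx
    rcases h1 with h1 | h1
    · refine ⟨Sum.inl ⟨par (X := Path n) x, by omega⟩, ?_⟩
      apply Subtype.ext
      exact step_ext (X := Path n) rfl h2.symm
    · refine ⟨Sum.inr ⟨par (X := Path n) x, by omega⟩, ?_⟩
      apply Subtype.ext
      exact step_ext (X := Path n) rfl h2.symm

lemma cnt_big (n a : ℕ) (h : n < a) : cnt n a = 0 := by
  unfold cnt
  rw [Fintype.card_eq_zero_iff]
  exact ⟨fun x => by have := Path_le n x.1; have := x.2; omega⟩

lemma cnt_top (n : ℕ) : cnt n n = 1 := by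
  induction n with
  | zero => rfl
  | succ n ih => rw [cnt_succ, ih, cnt_big n (n + 2) (by omega)]

lemma cnt_eq (n : ℕ) : ∀ j, 2 * (j + 1) ≤ n →
    cnt n (n - 2 * (j + 1)) + n.choose j = n.choose (j + 1) := by
  induction n with
  | zero => intro j hj; omega
  | succ n ih =>
    intro j hj
    rcases Nat.eq_or_lt_of_le hj with h | h
    · obtain rfl : n = 2 * j + 1 := by omega
      rw [show 2 * j + 1 + 1 - 2 * (j + 1) = 0 by omega, cnt_zero_right]
      have hs : (2 * j + 1).choose (j + 1) = (2 * j + 1).choose j :=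
        Nat.choose_symm_half j
      rcases j with _ | j
      · decide
      · have := ih j (by omega)
        rw [show 2 * (j + 1) + 1 - 2 * (j + 1) = 1 by omega] at this
        rw [Nat.choose_succ_succ (2 * (j + 1) + 1) j,
          Nat.choose_succ_succ (2 * (j + 1) + 1) (j + 1)]
        simp only [Nat.succ_eq_add_one] at *
        omega
    · rw [show n + 1 - 2 * (j + 1) = (n - 2 * (j + 1)) + 1 by omega, cnt_succ]
      have h1 := ih j (by omega)
      rw [show n - 2 * (j + 1) + 2 = n - 2 * j by omega]
      rcases j with _ | j
      · simp only [Nat.mul_zero, Nat.sub_zero, cnt_top, Nat.choose_zero_right] at *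
        simp only [zero_add, Nat.choose_one_right] at *
        omega
      · have h2 := ih j (by omega)
        rw [Nat.choose_succ_succ n j, Nat.choose_succ_succ n (j + 1)]
        simp only [Nat.succ_eq_add_one] at *
        omega

lemma cnt_final (n j : ℕ) (h : j < n / 2 + 1) :
    cnt n (n - 2 * j) = n.choose j - if j = 0 then 0 else n.choose (j - 1) := by
  rcases j with _ | j
  · simp [cnt_top]
  · have := cnt_eq n j (by omega)
    simp only [Nat.add_sub_cancel, if_neg (Nat.succ_ne_zero j)]
    omega

/-! ### Splitting block matrices -/

/-- block restriction -/
def blkHom (X : Gr) (a : ℕ) : A X →ₐ[ℂ] Matrix {x : X.T // X.e x = a} {x : X.T // X.e x = a} ℂ :=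
  AlgHom.ofLinearMap
    { toFun := fun M => M.1.submatrix Subtype.val Subtype.val
      map_add' := fun _ _ => rfl
      map_smul' := fun _ _ => rfl }
    (by
      ext x y
      change (1 : Matrix X.T X.T ℂ) x.1 y.1 = _
      simp only [Matrix.one_apply, Subtype.ext_iff])
    (by
      intro M N
      ext x y
      change (M.1 * N.1) x.1 y.1 = ∑ r : {x : X.T // X.e x = a}, M.1 x.1 r.1 * N.1 r.1 y.1
      rw [Matrix.mul_apply]
      symm
      apply Finset.sum_bij_ne_zero (fun r _ _ => r.1)
      · intros; exact Finset.mem_univ _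
      · intro r _ _ s _ _ h; exact Subtype.ext h
      · intro r _ hr
        have := M.2 _ _ (left_ne_zero_of_mul hr)
        exact ⟨⟨r, this.symm.trans x.2⟩, Finset.mem_univ _, hr, rfl⟩
      · intros; rfl)

lemma blkHom_apply (X : Gr) (a : ℕ) (M : A X) (x y : {x : X.T // X.e x = a}) :
    blkHom X a M x y = M.1 x.1 y.1 := rfl

/-- all blocks -/
def blks (n : ℕ) : A (Path n) →ₐ[ℂ] ∀ j : Fin (n / 2 + 1),
    Matrix {x : (Path n).T // (Path n).e x = n - 2 * j} {x : (Path n).T // (Path n).e x = n - 2 * j}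
      ℂ :=
  Pi.algHom ℂ _ fun j => blkHom (Path n) (n - 2 * j)

lemma ex_j (n : ℕ) (x : (Path n).T) : ∃ j : Fin (n / 2 + 1), (Path n).e x = n - 2 * j := by
  have h1 := Path_le n x
  have h2 := Path_mod n x
  exact ⟨⟨(n - (Path n).e x) / 2, by omega⟩, by simp only; omega⟩

lemma blks_bij (n : ℕ) : Function.Bijective (blks n) := by
  constructor
  · intro M N h
    apply Subtype.ext
    ext x y
    by_cases hxy : (Path n).e x = (Path n).e y
    · obtain ⟨j, hj⟩ := ex_j n x
      exact congrFun (congrFun (congrFun h j) ⟨x, hj⟩) ⟨y, hxy.symm.trans hj⟩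
    · have h1 : M.1 x y = 0 := by
        by_contra h'; exact hxy (M.2 _ _ h')
      have h2 : N.1 x y = 0 := by
        by_contra h'; exact hxy (N.2 _ _ h')
      rw [h1, h2]
  · intro F
    choose jj hjj using ex_j n
    refine ⟨⟨fun x y => if h : (Path n).e x = (Path n).e y then
      F (jj x) ⟨x, hjj x⟩ ⟨y, h.symm.trans (hjj x)⟩ else 0, ?_⟩, ?_⟩
    · intro x y h
      by_contra h'
      exact h (dif_neg h')
    · funext j
      ext ⟨x, hx⟩ ⟨y, hy⟩
      change (if h : (Path n).e x = (Path n).e y then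
        F (jj x) ⟨x, hjj x⟩ ⟨y, h.symm.trans (hjj x)⟩ else 0) = _
      rw [dif_pos (hx.trans hy.symm)]
      have : jj x = j := by
        have h1 := hjj x
        have h2 := (jj x).2
        have h3 := j.2
        apply Fin.ext
        omega
      subst this
      rfl

theorem final (q : ℂ) (hq : q ≠ 0) (n : ℕ)
    (hk : ∀ k : ℕ, 1 ≤ k → k ≤ n → qInt q k ≠ 0) :
    Nonempty (TL (q + q⁻¹) n ≃ₐ[ℂ]
      ∀ j : Fin (n / 2 + 1),
        Matrix
          (Fin (n.choose j - if (j : ℕ) = 0 then 0 else n.choose ((j : ℕ) - 1)))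
          (Fin (n.choose j - if (j : ℕ) = 0 then 0 else n.choose ((j : ℕ) - 1)))
          ℂ) := by
  obtain ⟨φ, -, hφ⟩ := TL_path (qInt q) (q + q⁻¹) (qInt_zero q) (qInt_rec q hq) n hk
  refine ⟨((AlgEquiv.ofBijective φ hφ).trans (AlgEquiv.ofBijective (blks n) (blks_bij n))).trans
    (AlgEquiv.piCongrRight fun j => Matrix.reindexAlgEquiv ℂ ℂ
      (Fintype.equivFinOfCardEq (cnt_final n j j.2)))⟩

end TLP

/-- Let `q ∈ ℂ`, `q ≠ 0`, `d = q + q⁻¹`, `n ≥ 1`, and assume `[k]_q ≠ 0` for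
`1 ≤ k ≤ n`.  Then there is an isomorphism of `ℂ`-algebras from `TL_n(d)` onto the
product over `j = 0, …, ⌊n/2⌋` of the full matrix algebras `M_{m_j}(ℂ)`, where
`m_j = C(n,j) − C(n,j−1)` (with `C(n,−1) = 0`). -/
theorem stmt10 (q : ℂ) (hq : q ≠ 0) (n : ℕ) (hn : 1 ≤ n)
    (hk : ∀ k : ℕ, 1 ≤ k → k ≤ n → qInt q k ≠ 0) :
    Nonempty (TL (q + q⁻¹) n ≃ₐ[ℂ]
      ∀ j : Fin (n / 2 + 1),
        Matrix
          (Fin (n.choose j - if (j : ℕ) = 0 then 0 else n.choose ((j : ℕ) - 1)))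
          (Fin (n.choose j - if (j : ℕ) = 0 then 0 else n.choose ((j : ℕ) - 1)))
          ℂ) := by
  exact TLP.final q hq n hk
end

section
/- Let q ∈ ℂ, q ≠ 0, d = q + q⁻¹, and let n ≥ 1. Assume the quantum integers [k]_q are nonzero for all 1 ≤ k ≤ n. Define elements f_1, f_2, …, f_n of TL_n(d) by f_1 = 1 and the Wenzl recursion f_{k+1} = f_k − ([k]_q/[k+1]_q)·f_k·h_k·f_k for 1 ≤ k ≤ n−1 (viewing all f_k inside TL_n(d) via the inclusions of generators). Then each f_k is a nonzero idempotent (f_k² = f_k, f_k ≠ 0) and satisfies h_i·f_k = f_k·h_i = 0 for every 1 ≤ i ≤ k−1. -/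
theorem TLh_eq (d : ℂ) (n i : ℕ) (h : 1 ≤ i ∧ i ≤ n - 1) :
    TLh d n i = TLgen d n ⟨i - 1, by omega⟩ := by
  unfold TLh; rw [dif_pos h]

theorem TLh_sq (d : ℂ) (n i : ℕ) (h : 1 ≤ i ∧ i ≤ n - 1) :
    TLh d n i * TLh d n i = d • TLh d n i := by
  rw [TLh_eq d n i h]
  unfold TLgen
  rw [← map_mul, RingQuot.mkAlgHom_rel ℂ (TLRel.sq _), map_smul]

theorem TLh_comm (d : ℂ) (n i j : ℕ) (hi : 1 ≤ i ∧ i ≤ n - 1) (hj : 1 ≤ j ∧ j ≤ n - 1)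
    (h : i + 2 ≤ j) : TLh d n i * TLh d n j = TLh d n j * TLh d n i := by
  rw [TLh_eq d n i hi, TLh_eq d n j hj]
  unfold TLgen
  rw [← map_mul, RingQuot.mkAlgHom_rel ℂ (TLRel.comm _ _ (Or.inl _)), map_mul]
  simp only
  omega

theorem TLh_hook (d : ℂ) (n i : ℕ) (hi : 1 ≤ i) (hj : i + 1 ≤ n - 1) :
    TLh d n (i + 1) * TLh d n i * TLh d n (i + 1) = TLh d n (i + 1) := by
  rw [TLh_eq d n i (by omega), TLh_eq d n (i + 1) (by omega)]
  unfold TLgen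
  rw [← map_mul, ← map_mul, RingQuot.mkAlgHom_rel ℂ (TLRel.hook _ _ (Or.inr _))]
  simp only
  omega

/-- The character of `TL_n(d)` that kills all generators. -/
theorem TL_counit (d : ℂ) (n : ℕ) : ∃ φ : TL d n →ₐ[ℂ] ℂ, ∀ i, φ (TLh d n i) = 0 := by
  refine ⟨RingQuot.liftAlgHom ℂ ⟨FreeAlgebra.lift ℂ (fun _ => (0 : ℂ)), ?_⟩, ?_⟩
  · intro x y h
    cases h <;> simp
  · intro i
    unfold TLh
    split_ifs with h
    · unfold TLgen
      simp
    · simp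

theorem qInt_one (q : ℂ) (h : qInt q 1 ≠ 0) : qInt q 1 = 1 := by
  unfold qInt at *
  split_ifs at * with h2
  · simp
  · simp only [pow_one] at *
    apply div_self
    intro h0
    simp [h0] at h

theorem qInt_rec (q : ℂ) (hq : q ≠ 0) (k : ℕ) :
    (q + q⁻¹) * qInt q (k + 1) = qInt q (k + 2) + qInt q k := by
  unfold qInt
  split_ifs with h2
  · have hi : q⁻¹ = q := by
      field_simp
      rw [h2]
    rw [hi]
    cases k with
    | zero => simp; ring
    | succ k =>
      simp only [Nat.add_sub_cancel, show k + 1 + 2 - 1 = k + 2 by omega]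
      push_cast
      linear_combination (q ^ k * (k + 1)) * h2
  · have : q * q⁻¹ = 1 := mul_inv_cancel₀ hq
    rw [← mul_div_assoc, ← add_div]
    congr 1
    generalize q⁻¹ = p at *
    linear_combination (q ^ k - p ^ k) * this

theorem wenzl_step {A : Type*} [Ring A] [Algebra ℂ A] (f g h : A) (c : ℂ) (hc : c ≠ 0)
    (hff : f * f = f) (h1 : f * h * f * h = c • (f * h)) (h2 : h * f * h * f = c • (h * f))
    (hg : g = f - c⁻¹ • (f * h * f)) :
    g * g = g ∧ f * g = g ∧ g * f = g ∧ g * h = 0 ∧ h * g = 0 := by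
  have e1 : f * g = g := by
    rw [hg, mul_sub, mul_smul_comm, ← mul_assoc, ← mul_assoc, hff]
  have e2 : g * f = g := by
    rw [hg, sub_mul, smul_mul_assoc, mul_assoc _ f f, hff]
  have e3 : g * h = 0 := by
    rw [hg, sub_mul, smul_mul_assoc, h1, smul_smul, inv_mul_cancel₀ hc, one_smul, sub_self]
  have e4 : h * g = 0 := by
    rw [hg, mul_sub, mul_smul_comm, ← mul_assoc, ← mul_assoc, h2, smul_smul,
      inv_mul_cancel₀ hc, one_smul, sub_self]
  refine ⟨?_, e1, e2, e3, e4⟩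
  calc g * g = g * (f - c⁻¹ • (f * h * f)) := by rw [← hg]
    _ = g * f - c⁻¹ • (g * f * h * f) := by
        rw [mul_sub, mul_smul_comm]; simp only [mul_assoc]
    _ = g := by rw [e2, e3]; simp

theorem wenzl_hgh {A : Type*} [Ring A] [Algebra ℂ A] (f g h H : A) (c d : ℂ)
    (hff : f * f = f) (hH : H * H = d • H) (hk : H * h * H = H) (hc : f * H = H * f)
    (hg : g = f - c⁻¹ • (f * h * f)) :
    H * g * H = (d - c⁻¹) • (f * H) := by
  have a1 : H * f * H = d • (f * H) := by rw [← hc, mul_assoc, hH, mul_smul_comm]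
  have a2 : H * (f * h * f) * H = f * H := by
    calc H * (f * h * f) * H = (H * f) * h * (f * H) := by simp only [mul_assoc]
      _ = (f * H) * h * (H * f) := by rw [← hc]
      _ = f * (H * h * H) * f := by simp only [mul_assoc]
      _ = f * H := by rw [hk, mul_assoc, ← hc, ← mul_assoc, hff]
  rw [hg, mul_sub, sub_mul, mul_smul_comm, smul_mul_assoc, a1, a2, sub_smul]

/-- Let `q ∈ ℂ`, `q ≠ 0`, `d = q + q⁻¹`, `n ≥ 1`, and assume `[k]_q ≠ 0` for
`1 ≤ k ≤ n`.  Let `f : ℕ → TL_n(d)` satisfy `f 1 = 1` and the Wenzl recursion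
`f (k+1) = f k − ([k]_q/[k+1]_q)·(f k · h_k · f k)` for `1 ≤ k ≤ n−1`.  Then for
every `1 ≤ k ≤ n`, `f k` is a nonzero idempotent and `h_i · f k = f k · h_i = 0`
for every `1 ≤ i ≤ k−1`. -/
theorem stmt11 (q : ℂ) (hq : q ≠ 0) (n : ℕ) (hn : 1 ≤ n)
    (hk : ∀ k : ℕ, 1 ≤ k → k ≤ n → qInt q k ≠ 0)
    (f : ℕ → TL (q + q⁻¹) n) (hf1 : f 1 = 1)
    (hfrec : ∀ k : ℕ, 1 ≤ k → k ≤ n - 1 →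
      f (k + 1) = f k - (qInt q k / qInt q (k + 1)) •
        (f k * TLh (q + q⁻¹) n k * f k)) :
    ∀ k : ℕ, 1 ≤ k → k ≤ n →
      (f k * f k = f k ∧ f k ≠ 0 ∧
       ∀ i : ℕ, 1 ≤ i → i ≤ k - 1 →
         TLh (q + q⁻¹) n i * f k = 0 ∧ f k * TLh (q + q⁻¹) n i = 0) := by
  revert f
  generalize hd : q + q⁻¹ = d
  intro f hf1 hfrec
  have key : ∀ k : ℕ, 1 ≤ k → k ≤ n →
      (f k * f k = f k ∧
       (∀ i : ℕ, 1 ≤ i → i ≤ k - 1 → TLh d n i * f k = 0 ∧ f k * TLh d n i = 0) ∧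
       (∀ j : ℕ, k + 1 ≤ j → j ≤ n - 1 → f k * TLh d n j = TLh d n j * f k) ∧
       (k ≤ n - 1 →
        f k * TLh d n k * f k * TLh d n k = (qInt q (k + 1) / qInt q k) • (f k * TLh d n k) ∧
        TLh d n k * f k * TLh d n k * f k =
          (qInt q (k + 1) / qInt q k) • (TLh d n k * f k))) := by
    intro k h1
    induction k, h1 using Nat.le_induction with
    | base =>
      intro _
      refine ⟨by simp [hf1], fun i _ _ => by omega, fun j _ _ => by simp [hf1], fun h => ?_⟩
      have e1 := qInt_one q (hk 1 le_rfl hn)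
      have e2 : qInt q (1 + 1) = d := by
        have := qInt_rec q hq 0
        have h0 : qInt q 0 = 0 := by simp [qInt]
        rw [h0, zero_add, e1, hd] at this
        simpa using this.symm
      rw [e1, e2, hf1]
      simp [TLh_sq d n 1 ⟨le_rfl, h⟩]
    | succ k h1 ih =>
      intro hkn
      obtain ⟨hff, hann, hcom, hA⟩ := ih (by omega)
      obtain ⟨hA1, hA2⟩ := hA (by omega)
      have q0 := hk k h1 (by omega)
      have q1 := hk (k + 1) (by omega) hkn
      have hg := hfrec k h1 (by omega)
      have hci : qInt q k / qInt q (k + 1) = (qInt q (k + 1) / qInt q k)⁻¹ := by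
        rw [inv_div]
      rw [hci] at hg
      obtain ⟨s1, s2, s3, s4, s5⟩ :=
        wenzl_step (f k) (f (k + 1)) (TLh d n k) _ (div_ne_zero q1 q0) hff hA1 hA2 hg
      refine ⟨s1, ?_, ?_, ?_⟩
      · intro i hi1 hi2
        rcases Nat.lt_or_ge i k with hlt | hge
        · obtain ⟨b1, b2⟩ := hann i hi1 (by omega)
          constructor
          · rw [← s2, ← mul_assoc, b1, zero_mul]
          · rw [← s3, mul_assoc, b2, mul_zero]
        · have : i = k := by omega
          subst this
          exact ⟨s5, s4⟩
      · intro j hj1 hj2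
        have c1 : Commute (f k) (TLh d n j) := hcom j (by omega) hj2
        have c2 : Commute (TLh d n k) (TLh d n j) :=
          TLh_comm d n k j (by omega) (by omega) (by omega)
        rw [hg]
        exact (c1.sub_left (((c1.mul_left c2).mul_left c1).smul_left _)).eq
      · intro hk1
        have hc := hcom (k + 1) le_rfl hk1
        have e := wenzl_hgh (f k) (f (k + 1)) (TLh d n k) (TLh d n (k + 1)) _ d hff
          (TLh_sq d n _ (by omega)) (TLh_hook d n k h1 hk1) hc hg
        have hcc : d - (qInt q (k + 1) / qInt q k)⁻¹ = qInt q (k + 1 + 1) / qInt q (k + 1) := by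
          have := qInt_rec q hq k
          rw [inv_div, eq_div_iff q1, sub_mul, div_mul_cancel₀ _ q1, ← hd, this]
          ring
        rw [hcc] at e
        constructor
        · rw [mul_assoc, mul_assoc, ← mul_assoc (TLh d n (k + 1)), e, mul_smul_comm,
            ← mul_assoc, s3]
        · rw [e, smul_mul_assoc, hc, mul_assoc, s2]
  obtain ⟨φ, hφ⟩ := TL_counit d n
  have hone : ∀ k : ℕ, 1 ≤ k → k ≤ n → φ (f k) = 1 := by
    intro k h1
    induction k, h1 using Nat.le_induction with
    | base => intro _; rw [hf1, map_one]
    | succ k h1 ih =>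
      intro hkn
      rw [hfrec k h1 (by omega), map_sub, map_smul, map_mul, map_mul, hφ, ih (by omega)]
      simp
  intro k h1 h2
  obtain ⟨a, b, -, -⟩ := key k h1 h2
  refine ⟨a, ?_, b⟩
  intro h0
  have := hone k h1 h2
  rw [h0, map_zero] at this
  exact zero_ne_one this
end

section
/- Let q ∈ ℂ be such that q² is a primitive l-th root of unity for some integer l ≥ 3, and set d = q + q⁻¹. Consider the radical of the Markov trace form, Rad_k = { x ∈ TL_k(d) : Tr_k(x·y) = 0 for all y ∈ TL_k(d) }. Then Rad_k = {0} for every 1 ≤ k < l−1, while Rad_{l−1} = ℂ·f_{l−1} is the one-dimensional subspace spanned by the Jones–Wenzl idempotent f_{l−1}. -/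
/-- Temperley-Lieb system in an algebra: `h 1, …, h N` satisfy the relations. -/
structure TLSys {R : Type} [Ring R] [Algebra ℂ R] (d : ℂ) (N : ℕ) (h : ℕ → R) : Prop where
  sq : ∀ i, h i * h i = d • h i
  comm : ∀ i j, i + 2 ≤ j → h i * h j = h j * h i
  hookR : ∀ i, 1 ≤ i → i + 1 ≤ N → h i * h (i + 1) * h i = h i
  hookL : ∀ i, 1 ≤ i → i + 1 ≤ N → h (i + 1) * h i * h (i + 1) = h (i + 1)

/-- subalgebra generated by the first generators -/
def TLsub {R : Type} [Ring R] [Algebra ℂ R] (h : ℕ → R) (k : ℕ) : Subalgebra ℂ R :=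
  Algebra.adjoin ℂ {x | ∃ i, 1 ≤ i ∧ i < k ∧ x = h i}

/-- Jones-Wenzl elements -/
noncomputable def JW {R : Type} [Ring R] [Algebra ℂ R] (q : ℂ) (h : ℕ → R) : ℕ → R
  | 0 => 1
  | k + 1 => JW q h k - (qInt q k / qInt q (k + 1)) • (JW q h k * h k * JW q h k)

section abstractTL
variable {R : Type} [Ring R] [Algebra ℂ R] {d : ℂ} {N : ℕ} {h : ℕ → R}

theorem TLsub_mono {k m : ℕ} (hkm : k ≤ m) : TLsub h k ≤ TLsub h m := by
  apply Algebra.adjoin_mono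
  rintro x ⟨i, h1, h2, rfl⟩
  exact ⟨i, h1, by omega, rfl⟩

theorem TLsub_gen {k i : ℕ} (h1 : 1 ≤ i) (h2 : i < k) : h i ∈ TLsub h k :=
  Algebra.subset_adjoin ⟨i, h1, h2, rfl⟩

theorem TLsub_comm (H : TLSys d N h) {k j : ℕ} (hkj : k + 1 ≤ j) {x : R} (hx : x ∈ TLsub h k) :
    x * h j = h j * x := by
  induction hx using Algebra.adjoin_induction with
  | mem x hx =>
    obtain ⟨i, h1, h2, rfl⟩ := hx
    exact H.comm i j (by omega)
  | algebraMap r => exact Algebra.commutes r _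
  | add x y _ _ hx hy => rw [add_mul, mul_add, hx, hy]
  | mul x y _ _ hx hy => rw [mul_assoc, hy, ← mul_assoc, hx, mul_assoc]

/-- The spanning submodule. -/
def TLspan (h : ℕ → R) (k : ℕ) : Submodule ℂ R :=
  Submodule.span ℂ {x | x ∈ TLsub h k ∨ ∃ a ∈ TLsub h k, ∃ b ∈ TLsub h k, x = a * h k * b}

theorem TLspan_sand (H : TLSys d N h) {k : ℕ} (hk1 : 1 ≤ k) (hk : k + 1 ≤ N) {y : R}
    (hy : y ∈ TLspan h k) : ∃ e ∈ TLsub h k, h (k + 1) * y * h (k + 1) = e * h (k + 1) := by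
  induction hy using Submodule.span_induction with
  | mem x hx =>
    rcases hx with hx | ⟨a, ha, b, hb, rfl⟩
    · refine ⟨d • x, Subalgebra.smul_mem _ hx d, ?_⟩
      rw [← TLsub_comm H le_rfl hx, mul_assoc, H.sq, mul_smul_comm, smul_mul_assoc]
    · refine ⟨a * b, mul_mem ha hb, ?_⟩
      have ca := TLsub_comm H le_rfl ha
      have cb := TLsub_comm H le_rfl hb
      calc h (k + 1) * (a * h k * b) * h (k + 1)
          = (h (k + 1) * a) * h k * (b * h (k + 1)) := by simp only [mul_assoc]
        _ = a * (h (k + 1) * h k * h (k + 1)) * b := by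
            rw [← ca, cb]; simp only [mul_assoc]
        _ = a * b * h (k + 1) := by rw [H.hookL k hk1 hk, mul_assoc, ← cb, mul_assoc]
  | zero => exact ⟨0, zero_mem _, by simp⟩
  | add x y _ _ hx hy =>
    obtain ⟨e, he, h1⟩ := hx
    obtain ⟨e', he', h2⟩ := hy
    exact ⟨e + e', add_mem he he', by rw [mul_add, add_mul, h1, h2, add_mul]⟩
  | smul c x _ hx =>
    obtain ⟨e, he, h1⟩ := hx
    exact ⟨c • e, Subalgebra.smul_mem _ he c, by
      rw [mul_smul_comm, smul_mul_assoc, h1, smul_mul_assoc]⟩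

theorem TLsub_one {x : R} (hx : x ∈ TLsub h 1) : ∃ c : ℂ, x = c • 1 := by
  have : {x | ∃ i, 1 ≤ i ∧ i < 1 ∧ x = h i} = (∅ : Set R) := by
    ext x; simp only [Set.mem_ofPred_eq, Set.mem_empty_iff_false, iff_false]
    rintro ⟨i, h1, h2, _⟩; omega
  rw [TLsub, this, Algebra.adjoin_empty, Algebra.mem_bot] at hx
  obtain ⟨c, rfl⟩ := hx
  exact ⟨c, Algebra.algebraMap_eq_smul_one c⟩

theorem TLsub_le_span_aux {k : ℕ} (hk1 : 1 ≤ k)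
    (hs : ∀ y ∈ TLsub h k, ∃ e ∈ TLsub h k, h k * y * h k = e * h k) :
    ∀ y ∈ TLsub h (k + 1), y ∈ TLspan h k := by
  have key : ∀ y ∈ TLsub h (k + 1), ∀ z ∈ TLspan h k, y * z ∈ TLspan h k := by
    intro y hy
    induction hy using Algebra.adjoin_induction with
    | mem x hx =>
      obtain ⟨i, h1, h2, rfl⟩ := hx
      intro z hz
      induction hz using Submodule.span_induction with
      | mem z hz =>
        rcases lt_or_eq_of_le (Nat.lt_succ_iff.mp h2) with h3 | rfl
        · have hi := TLsub_gen (h := h) h1 h3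
          rcases hz with hz | ⟨a, ha, b, hb, rfl⟩
          · exact Submodule.subset_span (Or.inl (mul_mem hi hz))
          · exact Submodule.subset_span (Or.inr ⟨h i * a, mul_mem hi ha, b, hb, by
              simp only [mul_assoc]⟩)
        · rcases hz with hz | ⟨a, ha, b, hb, rfl⟩
          · exact Submodule.subset_span (Or.inr ⟨1, one_mem _, z, hz, by simp⟩)
          · obtain ⟨e, he, h4⟩ := hs a ha
            refine Submodule.subset_span (Or.inr ⟨e, he, b, hb, ?_⟩)
            rw [← h4]; simp only [mul_assoc]
      | zero => simp
      | add x y _ _ hx hy => rw [mul_add]; exact add_mem hx hy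
      | smul c x _ hx => rw [mul_smul_comm]; exact Submodule.smul_mem _ c hx
    | algebraMap r =>
      intro z hz
      rw [← Algebra.smul_def]; exact Submodule.smul_mem _ r hz
    | add x y _ _ hx hy => intro z hz; rw [add_mul]; exact add_mem (hx z hz) (hy z hz)
    | mul x y _ _ hx hy => intro z hz; rw [mul_assoc]; exact hx _ (hy z hz)
  intro y hy
  have := key y hy 1 (Submodule.subset_span (Or.inl (one_mem _)))
  rwa [mul_one] at this

theorem TLsub_sand (H : TLSys d N h) : ∀ k : ℕ, 1 ≤ k → k ≤ N →
    ∀ y ∈ TLsub h k, ∃ e ∈ TLsub h k, h k * y * h k = e * h k := by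
  intro k hk1
  induction k, hk1 using Nat.le_induction with
  | base =>
    intro _ y hy
    obtain ⟨c, rfl⟩ := TLsub_one hy
    refine ⟨(c * d) • 1, Subalgebra.smul_mem _ (one_mem _) _, ?_⟩
    simp [H.sq, smul_smul]
  | succ k hk ih =>
    intro hkN y hy
    obtain ⟨e, he, h1⟩ := TLspan_sand H hk hkN
      (TLsub_le_span_aux hk (ih (by omega)) y hy)
    exact ⟨e, TLsub_mono (Nat.le_succ k) he, h1⟩

theorem TLsub_mul_gen (H : TLSys d N h) {k : ℕ} (hk1 : 1 ≤ k) (hk : k ≤ N) {y : R}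
    (hy : y ∈ TLsub h (k + 1)) : ∃ e ∈ TLsub h k, y * h k = e * h k := by
  have hs := TLsub_sand H k hk1 hk
  have hy' := TLsub_le_span_aux hk1 hs y hy
  clear hy
  induction hy' using Submodule.span_induction with
  | mem x hx =>
    rcases hx with hx | ⟨a, ha, b, hb, rfl⟩
    · exact ⟨x, hx, rfl⟩
    · obtain ⟨e, he, h1⟩ := hs b hb
      refine ⟨a * e, mul_mem ha he, ?_⟩
      rw [mul_assoc a e, ← h1]; simp only [mul_assoc]
  | zero => exact ⟨0, zero_mem _, by simp⟩
  | add x y _ _ hx hy =>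
    obtain ⟨e, he, h1⟩ := hx
    obtain ⟨e', he', h2⟩ := hy
    exact ⟨e + e', add_mem he he', by rw [add_mul, h1, h2, add_mul]⟩
  | smul c x _ hx =>
    obtain ⟨e, he, h1⟩ := hx
    exact ⟨c • e, Subalgebra.smul_mem _ he c, by rw [smul_mul_assoc, h1, smul_mul_assoc]⟩

variable {q : ℂ}

theorem JW_mem (k : ℕ) : JW q h k ∈ TLsub h k := by
  induction k with
  | zero => exact (TLsub h 0).one_mem
  | succ k ih =>
    have i1 := TLsub_mono (Nat.le_succ k) ih
    rw [JW]
    rcases Nat.eq_zero_or_pos k with rfl | hk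
    · have : qInt q 0 = 0 := by simp [qInt]
      rw [this]; simpa using i1
    · exact sub_mem i1 (Subalgebra.smul_mem _
        (mul_mem (mul_mem i1 (TLsub_gen hk (Nat.lt_succ_self k))) i1) _)

theorem JW_main (H : TLSys d N h) (h0 : h 0 = 0)
    (hrec : ∀ k, qInt q (k + 2) = d * qInt q (k + 1) - qInt q k) (k : ℕ)
    (hne : ∀ i, 1 ≤ i → i ≤ k + 1 → qInt q i ≠ 0) (hk : k ≤ N) :
    JW q h k * JW q h k = JW q h k ∧ JW q h k * JW q h (k + 1) = JW q h (k + 1) ∧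
    JW q h (k + 1) * JW q h k = JW q h (k + 1) ∧
    JW q h (k + 1) * JW q h (k + 1) = JW q h (k + 1) ∧
    (∀ i, i ≤ k → h i * JW q h (k + 1) = 0) ∧ (∀ i, i ≤ k → JW q h (k + 1) * h i = 0) := by
  induction k with
  | zero =>
    have : JW q h 1 = 1 := by simp [JW, qInt]
    simp [this, JW, h0]
  | succ k ih =>
    obtain ⟨a1, a2, a3, a4, a5, a6⟩ := ih (fun i h1 h2 => hne i h1 (by omega)) (by omega)
    have n1 : qInt q (k + 1) ≠ 0 := hne _ (by omega) (by omega)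
    have n2 : qInt q (k + 2) ≠ 0 := hne _ (by omega) (by omega)
    set F := JW q h k with hF
    set G := JW q h (k + 1) with hG
    set e := h (k + 1) with he
    have cF : F * e = e * F := TLsub_comm H le_rfl (JW_mem k)
    -- the sandwich
    have sand : e * G * e = (qInt q (k + 2) / qInt q (k + 1)) • (F * e) := by
      have hGdef : G = F - (qInt q k / qInt q (k + 1)) • (F * h k * F) := rfl
      have e1 : e * F * e = d • (F * e) := by
        rw [← cF, mul_assoc, H.sq, mul_smul_comm]
      have e2 : (qInt q k / qInt q (k + 1)) • (e * (F * h k * F) * e)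
          = (qInt q k / qInt q (k + 1)) • (F * e) := by
        rcases Nat.eq_zero_or_pos k with rfl | hk0
        · simp [qInt]
        · congr 1
          calc e * (F * h k * F) * e = (e * F) * h k * (F * e) := by simp only [mul_assoc]
            _ = F * (e * h k * e) * F := by rw [← cF, cF]; nth_rewrite 1 [← cF]; simp only [mul_assoc]
            _ = F * e := by rw [H.hookL k hk0 hk, mul_assoc, ← cF, ← mul_assoc, a1]
      rw [hGdef, mul_sub, sub_mul, mul_smul_comm, smul_mul_assoc, e1, e2, ← sub_smul]
      congr 1
      rw [hrec]; field_simp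
    set c := qInt q (k + 1) / qInt q (k + 2) with hc
    have hcc : c * (qInt q (k + 2) / qInt q (k + 1)) = 1 := by rw [hc]; field_simp
    have hK : JW q h (k + 2) = G - c • (G * e * G) := rfl
    have b1 : G * JW q h (k + 2) = JW q h (k + 2) := by
      rw [hK, mul_sub, a4, mul_smul_comm, ← mul_assoc, ← mul_assoc, a4]
    have b2 : JW q h (k + 2) * G = JW q h (k + 2) := by
      rw [hK, sub_mul, a4, smul_mul_assoc, mul_assoc, a4]
    have z1 : e * JW q h (k + 2) = 0 := by
      rw [hK, mul_sub, mul_smul_comm, ← mul_assoc, ← mul_assoc, sand, smul_mul_assoc, smul_smul,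
        hcc, one_smul, cF, mul_assoc, a2, sub_self]
    have z2 : JW q h (k + 2) * e = 0 := by
      rw [hK, sub_mul, smul_mul_assoc, mul_assoc, mul_assoc, ← mul_assoc e, sand, mul_smul_comm,
        smul_smul, hcc, one_smul, ← mul_assoc, a3, sub_self]
    refine ⟨a4, b1, b2, ?_, ?_, ?_⟩
    · show JW q h (k + 2) * JW q h (k + 2) = JW q h (k + 2)
      have hK' : JW q h (k + 2) * JW q h (k + 2)
          = (G - c • (G * e * G)) * JW q h (k + 2) := by rw [← hK]
      rw [hK', sub_mul, b1, smul_mul_assoc, mul_assoc, b1, mul_assoc, z1, mul_zero, smul_zero, sub_zero]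
    · intro i hi
      rcases Nat.lt_or_ge i (k + 1) with h1 | h1
      · show h i * JW q h (k + 2) = 0
        rw [← b1, ← mul_assoc, a5 i (by omega), zero_mul]
      · obtain rfl : i = k + 1 := by omega
        exact z1
    · intro i hi
      rcases Nat.lt_or_ge i (k + 1) with h1 | h1
      · show JW q h (k + 2) * h i = 0
        rw [← b2, mul_assoc, a6 i (by omega), mul_zero]
      · obtain rfl : i = k + 1 := by omega
        exact z2

theorem JW_absorb {x : R} (k : ℕ) (hx : ∀ i, i < k → x * h i = 0) : x * JW q h k = x := by
  induction k with
  | zero => simp [JW]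
  | succ k ih =>
    have i1 := ih (fun i hi => hx i (by omega))
    rw [JW, mul_sub, i1, mul_smul_comm, ← mul_assoc, ← mul_assoc, i1, hx k (by omega)]
    simp

theorem TLsub_left_scalar {k : ℕ} {F : R} (hF : ∀ i, i < k → h i * F = 0) {x : R}
    (hx : x ∈ TLsub h k) : ∃ c : ℂ, x * F = c • F := by
  induction hx using Algebra.adjoin_induction with
  | mem x hx =>
    obtain ⟨i, h1, h2, rfl⟩ := hx
    exact ⟨0, by rw [hF i h2, zero_smul]⟩
  | algebraMap r => exact ⟨r, (Algebra.smul_def r F).symm⟩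
  | add x y _ _ hx hy =>
    obtain ⟨a, ha⟩ := hx
    obtain ⟨b, hb⟩ := hy
    exact ⟨a + b, by rw [add_mul, ha, hb, add_smul]⟩
  | mul x y _ _ hx hy =>
    obtain ⟨a, ha⟩ := hx
    obtain ⟨b, hb⟩ := hy
    exact ⟨b * a, by rw [mul_assoc, hb, mul_smul_comm, ha, smul_smul]⟩

theorem TLsub_right_scalar {k : ℕ} {F : R} (hF : ∀ i, i < k → F * h i = 0) {x : R}
    (hx : x ∈ TLsub h k) : ∃ c : ℂ, F * x = c • F := by
  induction hx using Algebra.adjoin_induction with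
  | mem x hx =>
    obtain ⟨i, h1, h2, rfl⟩ := hx
    exact ⟨0, by rw [hF i h2, zero_smul]⟩
  | algebraMap r => exact ⟨r, by rw [← Algebra.commutes, Algebra.smul_def]⟩
  | add x y _ _ hx hy =>
    obtain ⟨a, ha⟩ := hx
    obtain ⟨b, hb⟩ := hy
    exact ⟨a + b, by rw [mul_add, ha, hb, add_smul]⟩
  | mul x y _ _ hx hy =>
    obtain ⟨a, ha⟩ := hx
    obtain ⟨b, hb⟩ := hy
    exact ⟨a * b, by rw [← mul_assoc, ha, smul_mul_assoc, hb, smul_smul]⟩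

theorem JW_map {R' : Type} [Ring R'] [Algebra ℂ R'] {h' : ℕ → R'} (φ : R →ₐ[ℂ] R') (k : ℕ)
    (hφ : ∀ i, i < k → φ (h i) = h' i) : φ (JW q h k) = JW q h' k := by
  induction k with
  | zero => simp [JW]
  | succ k ih =>
    rw [JW, JW, map_sub, map_smul, map_mul, map_mul, ih (fun i hi => hφ i (by omega)),
      hφ k (by omega)]

end abstractTL

theorem TLh_zero (d : ℂ) (n : ℕ) : TLh d n 0 = 0 := by simp [TLh]

theorem TLh_of {d : ℂ} {n i : ℕ} (hi : 1 ≤ i ∧ i ≤ n - 1) :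
    TLh d n i = TLgen d n ⟨i - 1, by omega⟩ := by rw [TLh, dif_pos hi]

theorem TLh_not {d : ℂ} {n i : ℕ} (hi : ¬ (1 ≤ i ∧ i ≤ n - 1)) : TLh d n i = 0 := by
  rw [TLh, dif_neg hi]

theorem TL_sys (d : ℂ) (n : ℕ) : TLSys d (n - 1) (TLh d n) where
  sq i := by
    by_cases hi : 1 ≤ i ∧ i ≤ n - 1
    · rw [TLh_of hi, TLgen, ← map_mul, ← map_smul]
      exact RingQuot.mkAlgHom_rel ℂ (TLRel.sq _)
    · simp [TLh_not hi]
  comm i j hij := by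
    by_cases hi : 1 ≤ i ∧ i ≤ n - 1
    · by_cases hj : 1 ≤ j ∧ j ≤ n - 1
      · rw [TLh_of hi, TLh_of hj, TLgen, TLgen, ← map_mul, ← map_mul]
        exact RingQuot.mkAlgHom_rel ℂ (TLRel.comm _ _ (by left; simp only; omega))
      · simp [TLh_not hj]
    · simp [TLh_not hi]
  hookR i h1 h2 := by
    rw [TLh_of ⟨h1, by omega⟩, TLh_of (i := i + 1) ⟨by omega, h2⟩, TLgen, TLgen,
      ← map_mul, ← map_mul]
    exact RingQuot.mkAlgHom_rel ℂ (TLRel.hook _ _ (by left; simp only; omega))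
  hookL i h1 h2 := by
    rw [TLh_of ⟨h1, by omega⟩, TLh_of (i := i + 1) ⟨by omega, h2⟩, TLgen, TLgen,
      ← map_mul, ← map_mul]
    exact RingQuot.mkAlgHom_rel ℂ (TLRel.hook _ _ (by right; simp only; omega))

theorem TL_mem_sub (d : ℂ) (n : ℕ) (x : TL d n) : x ∈ TLsub (TLh d n) n := by
  obtain ⟨y, rfl⟩ := RingQuot.mkAlgHom_surjective ℂ (TLRel d (n - 1)) x
  induction y using FreeAlgebra.induction with
  | grade0 r => rw [AlgHom.commutes]; exact Subalgebra.algebraMap_mem _ r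
  | grade1 i =>
    have : TLh d n (i + 1) = TLgen d n i := TLh_of ⟨by omega, by omega⟩
    have h2 := TLsub_gen (h := TLh d n) (k := n) (i := i + 1) (by omega) (by omega)
    rw [this] at h2
    exact h2
  | mul a b ha hb => rw [map_mul]; exact mul_mem ha hb
  | add a b ha hb => rw [map_add]; exact add_mem ha hb

/-- augmentation -/
theorem TL_aug (d : ℂ) (n : ℕ) : ∃ ε : TL d n →ₐ[ℂ] ℂ, ∀ i, ε (TLh d n i) = 0 := by
  refine ⟨RingQuot.liftAlgHom ℂ ⟨FreeAlgebra.lift ℂ (fun _ => (0 : ℂ)), ?_⟩, ?_⟩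
  · intro x y hxy
    induction hxy <;> simp
  · intro i
    by_cases hi : 1 ≤ i ∧ i ≤ n - 1
    · rw [TLh_of hi, TLgen, RingQuot.liftAlgHom_mkAlgHom_apply]; simp
    · rw [TLh_not hi, map_zero]

theorem JW_ne_zero (q d : ℂ) (n k : ℕ) : JW q (TLh d n) k ≠ 0 := by
  obtain ⟨ε, hε⟩ := TL_aug d n
  intro h0
  have h1 : ε (JW q (TLh d n) k) = JW q (fun _ => (0 : ℂ)) k := JW_map ε k (fun i _ => hε i)
  have h2 : JW q (fun _ => (0 : ℂ)) k = 1 := by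
    induction k with
    | zero => rfl
    | succ k ih => 
      have := JW_absorb (q := q) (h := fun _ => (0 : ℂ)) (x := 1) (k + 1) (by simp)
      simpa using this
  rw [h0, map_zero, h2] at h1
  exact zero_ne_one h1

theorem qInt_facts (q : ℂ) (l : ℕ) (hl : 3 ≤ l) (hq : IsPrimitiveRoot (q ^ 2) l) :
    (∀ k, qInt q (k + 2) = (q + q⁻¹) * qInt q (k + 1) - qInt q k) ∧
    (∀ i, 1 ≤ i → i < l → qInt q i ≠ 0) ∧ qInt q l = 0 ∧ qInt q 1 = 1 := by
  have hq1 : q ^ 2 ≠ 1 := hq.ne_one (by omega)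
  have hq0 : q ≠ 0 := by
    rintro rfl
    have := hq.pow_eq_one
    rw [zero_pow two_ne_zero, zero_pow (by omega)] at this
    exact zero_ne_one this
  have hd : q - q⁻¹ ≠ 0 := by
    intro h
    apply hq1
    field_simp at h
    linear_combination h
  have hdef : ∀ k, qInt q k = (q ^ k - q⁻¹ ^ k) / (q - q⁻¹) := fun k => by rw [qInt, if_neg hq1]
  have hz : ∀ k, qInt q k = 0 ↔ (q ^ 2) ^ k = 1 := by
    intro k
    rw [hdef, div_eq_zero_iff, or_iff_left hd, sub_eq_zero, inv_pow,
      ← mul_eq_one_iff_eq_inv₀ (pow_ne_zero _ hq0), ← pow_add, ← pow_mul, two_mul]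
  refine ⟨?_, ?_, ?_, ?_⟩
  · intro k
    rw [hdef, hdef, hdef, ← mul_div_assoc, ← sub_div]
    congr 1
    have : q * q⁻¹ = 1 := mul_inv_cancel₀ hq0
    linear_combination (q⁻¹ ^ k - q ^ k) * this
  · intro i h1 h2 h3
    exact hq.pow_ne_one_of_pos_of_lt (by omega) h2 ((hz i).mp h3)
  · exact (hz l).mpr hq.pow_eq_one
  · rw [hdef, pow_one, pow_one, div_self hd]

/-- Let `q ∈ ℂ` be such that `q²` is a primitive `l`-th root of unity for some
`l ≥ 3`, and set `d = q + q⁻¹`.  Let `T` be the Markov trace family and consider the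
radical of the trace form `Rad_k = {x ∈ TL_k(d) : Tr_k(x·y) = 0 for all y}`.  Then
`Rad_k = {0}` for `1 ≤ k < l−1`, while `Rad_{l−1} = ℂ·f_{l−1}` is the one-dimensional
subspace spanned by the Jones–Wenzl idempotent `f_{l−1}`. -/
theorem stmt13 (q : ℂ) (l : ℕ) (hl : 3 ≤ l) (hq : IsPrimitiveRoot (q ^ 2) l)
    (ι : ∀ m : ℕ, TL (q + q⁻¹) m →ₐ[ℂ] TL (q + q⁻¹) (m + 1))
    (hι : ∀ (m : ℕ) (i : Fin (m - 1)),
      ι m (TLgen (q + q⁻¹) m i) = TLgen (q + q⁻¹) (m + 1) (Fin.castLE (by omega) i))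
    (T : ∀ m : ℕ, TL (q + q⁻¹) m →ₗ[ℂ] ℂ)
    (hT1 : T 1 1 = q + q⁻¹)
    (hT2 : ∀ m : ℕ, 1 ≤ m → ∀ x : TL (q + q⁻¹) m,
      T (m + 1) (ι m x) = (q + q⁻¹) * T m x)
    (hT3 : ∀ m : ℕ, 1 ≤ m → ∀ x y : TL (q + q⁻¹) m,
      T (m + 1) (ι m x * TLh (q + q⁻¹) (m + 1) m * ι m y) = T m (x * y))
    (f : ℕ → TL (q + q⁻¹) (l - 1)) (hf1 : f 1 = 1)
    (hfrec : ∀ k : ℕ, 1 ≤ k → k ≤ l - 2 →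
      f (k + 1) = f k - (qInt q k / qInt q (k + 1)) •
        (f k * TLh (q + q⁻¹) (l - 1) k * f k)) :
    (∀ k : ℕ, 1 ≤ k → k < l - 1 →
      ∀ x : TL (q + q⁻¹) k, (∀ y : TL (q + q⁻¹) k, T k (x * y) = 0) → x = 0) ∧
    f (l - 1) ≠ 0 ∧
    {x : TL (q + q⁻¹) (l - 1) |
        ∀ y : TL (q + q⁻¹) (l - 1), T (l - 1) (x * y) = 0}
      = {x : TL (q + q⁻¹) (l - 1) | ∃ c : ℂ, x = c • f (l - 1)} := by
  obtain ⟨hrec, hne, hql, hq1⟩ := qInt_facts q l hl hq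
  generalize q + q⁻¹ = d at *
  have h2 : qInt q 2 = d := by
    have := hrec 0
    have hz : qInt q 0 = 0 := by simp [qInt]
    rw [zero_add, zero_add, hq1, hz, mul_one, sub_zero] at this
    exact this
  have hd0 : d ≠ 0 := by rw [← h2]; exact hne 2 (by omega) (by omega)
  -- compatibility of the inclusion with the generators
  have hιh : ∀ m i, i < m → ι m (TLh d m i) = TLh d (m + 1) i := by
    intro m i him
    by_cases hi : 1 ≤ i
    · rw [TLh_of ⟨hi, by omega⟩, hι, TLh_of ⟨hi, by omega⟩]
      rfl
    · obtain rfl : i = 0 := by omega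
      rw [TLh_zero, TLh_zero, map_zero]
  have hιsurj : ∀ m, ∀ y ∈ TLsub (TLh d (m + 1)) m, ∃ w, ι m w = y := by
    intro m y hy
    have : TLsub (TLh d (m + 1)) m ≤ (ι m).range := by
      apply Algebra.adjoin_le
      rintro x ⟨i, _, h2, rfl⟩
      exact ⟨TLh d m i, hιh m i h2⟩
    exact this hy
  have hιJ : ∀ m, ι m (JW q (TLh d m) m) = JW q (TLh d (m + 1)) m := fun m =>
    JW_map (ι m) m (hιh m)
  have hJ : ∀ n k, k + 1 ≤ n → n < l → _ := fun n k hk hn =>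
    JW_main (TL_sys d n) (TLh_zero d n) hrec k (fun i h1 h3 => hne i h1 (by omega)) (by omega)
  -- trace of the Jones-Wenzl idempotents
  have hTJ : ∀ n, 1 ≤ n → n < l → T n (JW q (TLh d n) n) = qInt q (n + 1) := by
    intro n hn
    induction n, hn using Nat.le_induction with
    | base =>
      intro _
      have : JW q (TLh d 1) 1 = 1 := by simp [JW, qInt]
      rw [this, hT1, h2]
    | succ n hn ih =>
      intro hnl
      have ih := ih (by omega)
      obtain ⟨m, rfl⟩ : ∃ m, n = m + 1 := ⟨n - 1, by omega⟩
      have idem := (hJ (m + 1) m le_rfl (by omega)).2.2.2.1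
      have hn1 : qInt q (m + 1 + 1) ≠ 0 := hne _ (by omega) hnl
      rw [JW, ← hιJ (m + 1), map_sub, map_smul, hT2 _ hn, hT3 _ hn, idem, ih, hrec (m + 1),
        smul_eq_mul]
      field_simp
  -- nondegeneracy from one-dimensionality
  have hzero : ∀ n, 1 ≤ n → n < l - 1 → ∀ c : ℂ,
      (∀ y, T n (c • JW q (TLh d n) n * y) = 0) → c • JW q (TLh d n) n = 0 := by
    intro n hn hnl c hc
    have h3 := hc 1
    rw [mul_one, map_smul, hTJ n hn (by omega), smul_eq_mul] at h3
    rcases mul_eq_zero.mp h3 with h4 | h4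
    · rw [h4, zero_smul]
    · exact absurd h4 (hne _ (by omega) (by omega))
  have hK : ∀ n, 1 ≤ n → n ≤ l - 1 → ∀ x : TL d n, (∀ y, T n (x * y) = 0) →
      ∃ c : ℂ, x = c • JW q (TLh d n) n := by
    intro n hn
    induction n, hn using Nat.le_induction with
    | base =>
      intro _ x _
      obtain ⟨c, hc⟩ := TLsub_one (TL_mem_sub d 1 x)
      have : JW q (TLh d 1) 1 = 1 := by simp [JW, qInt]
      exact ⟨c, by rw [this, hc]⟩
    | succ n hn ih =>
      intro hnl x hx
      have hnd : ∀ w : TL d n, (∀ y, T n (w * y) = 0) → w = 0 := by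
        intro w hw
        obtain ⟨c, rfl⟩ := ih (by omega) w hw
        exact hzero n hn (by omega) c hw
      have hS : TLSys d n (TLh d (n + 1)) := TL_sys d (n + 1)
      have top : ∀ y, x * y * TLh d (n + 1) n = 0 := by
        intro y
        obtain ⟨e, he, h3⟩ := TLsub_mul_gen hS hn le_rfl (TL_mem_sub d (n + 1) (x * y))
        obtain ⟨w, rfl⟩ := hιsurj n e he
        have : w = 0 := by
          apply hnd
          intro z
          rw [← hT3 n hn w z, ← h3, mul_assoc, mul_assoc]
          exact hx _
        rw [h3, this, map_zero, zero_mul]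
      have all : ∀ j i, i + j = n → ∀ y, x * y * TLh d (n + 1) i = 0 := by
        intro j
        induction j with
        | zero =>
          intro i hi y
          obtain rfl : i = n := by omega
          exact top y
        | succ j ihj =>
          intro i hi y
          rcases Nat.eq_zero_or_pos i with rfl | h1
          · rw [TLh_zero, mul_zero]
          · rw [← hS.hookR i h1 (by omega), ← mul_assoc, ← mul_assoc, mul_assoc x y,
              ihj (i + 1) (by omega), zero_mul]
      have habs : x * JW q (TLh d (n + 1)) (n + 1) = x := by
        apply JW_absorb
        intro i hi
        have := all (n - i) i (by omega) 1
        rwa [mul_one] at this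
      obtain ⟨c, hc⟩ := TLsub_left_scalar (k := n + 1)
        (fun i hi => (hJ (n + 1) n le_rfl (by omega)).2.2.2.2.1 i (by omega))
        (TL_mem_sub d (n + 1) x)
      exact ⟨c, by rw [← hc, habs]⟩
  have hf : ∀ k, 1 ≤ k → k ≤ l - 1 → f k = JW q (TLh d (l - 1)) k := by
    intro k hk
    induction k, hk using Nat.le_induction with
    | base => intro _; rw [hf1]; simp [JW, qInt]
    | succ k hk ih =>
      intro hkl
      rw [hfrec k hk (by omega), ih (by omega), JW]
  have hfl := hf (l - 1) (by omega) le_rfl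
  refine ⟨?_, ?_, ?_⟩
  · intro k hk hkl x hx
    obtain ⟨c, rfl⟩ := hK k hk (by omega) x hx
    exact hzero k hk hkl c hx
  · rw [hfl]; exact JW_ne_zero _ _ _ _
  · ext x
    simp only [Set.mem_ofPred_eq, hfl]
    constructor
    · exact hK (l - 1) (by omega) le_rfl x
    · rintro ⟨c, rfl⟩ y
      have hJl := hJ (l - 1) (l - 2) (by omega) (by omega)
      have e1 : l - 2 + 1 = l - 1 := by omega
      rw [e1] at hJl
      obtain ⟨b, hb⟩ := TLsub_right_scalar (k := l - 1)
        (fun i hi => hJl.2.2.2.2.2 i (by omega)) (TL_mem_sub d (l - 1) y)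
      have e2 : l - 1 + 1 = l := by omega
      rw [smul_mul_assoc, hb, map_smul, map_smul, hTJ (l - 1) (by omega) (by omega), e2, hql]
      simp
end

section
/- For natural numbers n and j with 0 ≤ j ≤ ⌊n/2⌋, the number of sequences (s_1, …, s_n) with each s_t ∈ {+1, −1}, all partial sums s_1 + … + s_t nonnegative (t = 1, …, n), and total sum s_1 + … + s_n = n − 2j, equals C(n,j) − C(n,j−1), where C(n,j) is the binomial coefficient and C(n,−1) = 0. -/
/-- The set of ballot-type sequences of length `n` with total sum `m`. -/
def ballotSet (n : ℕ) (m : ℤ) : Set (Fin n → ℤ) :=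
  {s | (∀ t, s t = 1 ∨ s t = -1) ∧
      (∀ t : Fin n, 0 ≤ ∑ r ∈ Finset.univ.filter (fun r : Fin n => r ≤ t), s r) ∧
      (∑ t, s t = m)}

lemma ballotSet_finite (n : ℕ) (m : ℤ) : (ballotSet n m).Finite := by
  have h : (Set.pi Set.univ (fun _ : Fin n => ({1, -1} : Set ℤ))).Finite :=
    Set.Finite.pi (fun _ => by simp)
  refine h.subset ?_
  intro s hs t _
  simpa using hs.1 t

lemma mem_ballotSet_succ (n : ℕ) (m : ℤ) (s : Fin (n + 1) → ℤ) :
    s ∈ ballotSet (n + 1) m ↔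
      (s (Fin.last n) = 1 ∨ s (Fin.last n) = -1) ∧
      (fun i : Fin n => s i.castSucc) ∈ ballotSet n (m - s (Fin.last n)) ∧ 0 ≤ m := by
  have e1 : ∀ t : Fin n, ¬ (Fin.last n ≤ t.castSucc) := fun t => by
    simp
  have e2 : ∀ r : Fin n, r.castSucc ≤ Fin.last n := fun r => Fin.le_last _
  simp only [ballotSet, Set.mem_ofPred_eq, Finset.sum_filter, Fin.forall_fin_succ',
    Fin.sum_univ_castSucc, Fin.castSucc_le_castSucc_iff, e1, e2, if_true, if_false, le_refl,
    add_zero, eq_sub_iff_add_eq]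
  constructor
  · rintro ⟨⟨a, b⟩, ⟨c, d⟩, e⟩
    exact ⟨b, ⟨a, c, e⟩, e ▸ d⟩
  · rintro ⟨b, ⟨a, c, e⟩, d⟩
    exact ⟨⟨a, b⟩, ⟨c, e ▸ d⟩, e⟩

lemma ballotSet_succ_neg (n : ℕ) (m : ℤ) (hm : m < 0) : ballotSet (n + 1) m = ∅ := by
  ext s
  rw [mem_ballotSet_succ]
  simp only [Set.mem_empty_iff_false, iff_false]
  omega

lemma ballotSet_big (n : ℕ) (m : ℤ) (hm : (n : ℤ) < m) : ballotSet n m = ∅ := by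
  ext s
  simp only [Set.mem_empty_iff_false, iff_false]
  rintro ⟨h1, -, h3⟩
  have : ∑ t, s t ≤ ∑ _t : Fin n, (1 : ℤ) :=
    Finset.sum_le_sum (fun t _ => by rcases h1 t with h | h <;> omega)
  simp at this
  omega

lemma ballotSet_succ (n : ℕ) (m : ℤ) (hm : 0 ≤ m) :
    (ballotSet (n + 1) m).ncard = (ballotSet n (m - 1)).ncard + (ballotSet n (m + 1)).ncard := by
  have inj : ∀ a : ℤ, Function.Injective
      (fun s : Fin n → ℤ => (Fin.snoc s a : Fin (n + 1) → ℤ)) := by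
    intro a s s' h
    funext i
    simpa using congrFun h i.castSucc
  have key : ballotSet (n + 1) m =
      (fun s : Fin n → ℤ => (Fin.snoc s 1 : Fin (n + 1) → ℤ)) '' ballotSet n (m - 1) ∪
      (fun s : Fin n → ℤ => (Fin.snoc s (-1) : Fin (n + 1) → ℤ)) '' ballotSet n (m + 1) := by
    ext s
    rw [mem_ballotSet_succ]
    constructor
    · rintro ⟨h | h, h2, -⟩
      · left
        refine ⟨_, by simpa [h] using h2, ?_⟩
        funext i
        refine Fin.lastCases ?_ (fun i => ?_) i <;> simp [h]
      · right
        refine ⟨_, by simpa [h] using h2, ?_⟩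
        funext i
        refine Fin.lastCases ?_ (fun i => ?_) i <;> simp [h]
    · rintro (⟨s', h, rfl⟩ | ⟨s', h, rfl⟩)
      · simpa [hm] using h
      · simpa [hm] using h
  rw [key, Set.ncard_union_eq ?_ ((ballotSet_finite _ _).image _) ((ballotSet_finite _ _).image _),
    Set.ncard_image_of_injective _ (inj _), Set.ncard_image_of_injective _ (inj _)]
  rw [Set.disjoint_left]
  rintro _ ⟨s, -, rfl⟩ ⟨s', -, h⟩
  have := congrFun h (Fin.last n)
  simp at this

lemma ballotSet_zero : (ballotSet 0 0).ncard = 1 := by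
  have : ballotSet 0 0 = {Fin.elim0} := by
    ext s
    simp [ballotSet, eq_iff_true_of_subsingleton]
  rw [this, Set.ncard_singleton]

lemma ballotSet_card_zero (n : ℕ) : (ballotSet n n).ncard = 1 := by
  induction n with
  | zero => exact ballotSet_zero
  | succ n ih =>
    rw [ballotSet_succ _ _ (by positivity), ballotSet_big n (((n + 1 : ℕ) : ℤ) + 1) (by push_cast; omega),
      show ((n + 1 : ℕ) : ℤ) - 1 = n by push_cast; ring, ih, Set.ncard_empty]

lemma ballotSet_card (n : ℕ) : ∀ j : ℕ, 2 * (j + 1) ≤ n + 1 →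
    (ballotSet n ((n : ℤ) - 2 * ((j + 1 : ℕ) : ℤ))).ncard + n.choose j = n.choose (j + 1) := by
  induction n with
  | zero => intro j hj; omega
  | succ n ih =>
    intro j hj
    by_cases h : 2 * (j + 1) = n + 2
    · rw [ballotSet_succ_neg _ _ (by push_cast; omega), Set.ncard_empty, zero_add]
      exact Nat.choose_symm_of_eq_add (by omega)
    · rw [ballotSet_succ _ _ (by push_cast; omega)]
      have h1 := ih j (by omega)
      rw [show ((n + 1 : ℕ) : ℤ) - 2 * ((j + 1 : ℕ) : ℤ) - 1 = n - 2 * ((j + 1 : ℕ) : ℤ) by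
        push_cast; ring]
      rw [show ((n + 1 : ℕ) : ℤ) - 2 * ((j + 1 : ℕ) : ℤ) + 1 = n - 2 * (j : ℤ) by
        push_cast; ring]
      rw [Nat.choose_succ_succ' n j]
      cases j with
      | zero =>
        have h2 := ballotSet_card_zero n
        have e : (n : ℤ) - 2 * ((0 : ℕ) : ℤ) = n := by simp
        rw [e, h2]
        simp only [Nat.choose_zero_right] at h1 ⊢
        omega
      | succ k =>
        have h2 := ih k (by omega)
        rw [Nat.choose_succ_succ' n k]
        omega

/-- For natural numbers `n` and `j` with `j ≤ ⌊n/2⌋`, the number of sequences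
`(s_1, …, s_n)` with each `s_t ∈ {+1, −1}`, all partial sums nonnegative, and total
sum `n − 2j`, equals `C(n,j) − C(n,j−1)` (with `C(n,−1) = 0`). -/
theorem stmt17 (n j : ℕ) (hj : j ≤ n / 2) :
    Nat.card {s : Fin n → ℤ //
      (∀ t, s t = 1 ∨ s t = -1) ∧
      (∀ t : Fin n, 0 ≤ ∑ r ∈ Finset.univ.filter (fun r : Fin n => r ≤ t), s r) ∧
      (∑ t, s t = (n : ℤ) - 2 * (j : ℤ))}
      = n.choose j - (if j = 0 then 0 else n.choose (j - 1)) := by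
  change (ballotSet n ((n : ℤ) - 2 * (j : ℤ))).ncard = _
  cases j with
  | zero => simpa using ballotSet_card_zero n
  | succ k =>
    have h := ballotSet_card n k (by omega)
    simp only [Nat.succ_ne_zero, if_false, Nat.add_sub_cancel]
    omega
end
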